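/- arXiv:math/9906181 — 6 statements merged into one kernel-verified Lean document; each statement's English description precedes it below -/
import Mathlib

section
/- Let R be a unital ring and let I be an exchange ideal of R. If A, B, C, D are finitely generated projective right R-modules such that A ⊕ B ≅ C ⊕ D and at least one of A, B, C, D satisfies X·I = X, then there exist right R-modules Z₁₁, Z₁₂, Z₂₁, Z₂₂ such that A ≅ Z₁₁ ⊕ Z₁₂, B ≅ Z₂₁ ⊕ Z₂₂, C ≅ Z₁₁ ⊕ Z₂₁ and D ≅ Z₁₂ ⊕ Z₂₂. -/
open MulOpposite

/-- A two-sided ideal `I` of a unital ring `R` is an *exchange ideal* if for every `x ∈ I`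
there are an idempotent `e ∈ I` and `r, s ∈ I` with `e = x * r` and `e = x + s - x * s`. -/
def IsExchangeIdeal {R : Type*} [Ring R] (I : TwoSidedIdeal R) : Prop :=
  ∀ x ∈ I, ∃ e ∈ I, ∃ r ∈ I, ∃ s ∈ I,
    IsIdempotentElem e ∧ e = x * r ∧ e = x + s - x * s

/-- `X·I = X` for a right `R`-module `X` (viewed as a module over `Rᵐᵒᵖ`): the submodule
generated by all products `x·i` with `x ∈ X`, `i ∈ I` is all of `X`. -/
def FullOverIdeal {R : Type*} [Ring R] (I : TwoSidedIdeal R)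
    (X : Type*) [AddCommGroup X] [Module Rᵐᵒᵖ X] : Prop :=
  Submodule.span Rᵐᵒᵖ {y : X | ∃ (x : X) (i : R), i ∈ I ∧ y = op i • x} = ⊤

/-- The exchange condition for the elements of `J` lying in the corner `f T f`. -/
def IsCornerExchange {T : Type*} [Ring T] (J : Set T) (f : T) : Prop :=
  ∀ x ∈ J, f * x = x → x * f = x →
    ∃ e r t : T, e * e = e ∧ f * e = e ∧ e * f = e ∧ e = x * r ∧ f - e = (f - x) * t

theorem IsCornerExchange.add {T : Type*} [Ring T] {J : Set T}
    (hJ : ∀ x ∈ J, ∀ a b, a * x * b ∈ J) {f₁ f₂ : T}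
    (h₁₁ : f₁ * f₁ = f₁) (h₂₂ : f₂ * f₂ = f₂) (h₁₂ : f₁ * f₂ = 0) (h₂₁ : f₂ * f₁ = 0)
    (H₁ : IsCornerExchange J f₁) (H₂ : IsCornerExchange J f₂) :
    IsCornerExchange J (f₁ + f₂) := by
  intro x hx hfx hxf
  obtain ⟨f, hf⟩ : ∃ f, f = f₁ + f₂ := ⟨_, rfl⟩
  rw [← hf] at hfx hxf ⊢
  have hff : f * f = f := by rw [hf]; simp [mul_add, add_mul, *]
  have hf₁f : f₁ * f = f₁ := by rw [hf]; simp [mul_add, *]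
  have hff₁ : f * f₁ = f₁ := by rw [hf]; simp [add_mul, *]
  have hf₂f : f₂ * f = f₂ := by rw [hf]; simp [mul_add, *]
  have hff₂ : f * f₂ = f₂ := by rw [hf]; simp [add_mul, *]
  obtain ⟨e₁, r₁, t₁, he₁, hfe₁, hef₁, hr₁, ht₁⟩ := H₁ (f₁ * x * f₁) (hJ x hx _ _)
    (by simp only [← mul_assoc, h₁₁]) (by simp only [mul_assoc, h₁₁])
  obtain ⟨u₁, hu₁⟩ : ∃ u, u = f₁ * r₁ * e₁ := ⟨_, rfl⟩
  obtain ⟨v₁, hv₁⟩ : ∃ v, v = f₁ * t₁ * (f₁ - e₁) := ⟨_, rfl⟩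
  have he₁f₂ : e₁ * f₂ = 0 := by rw [← hef₁, mul_assoc, h₁₂, mul_zero]
  have hu₁e : u₁ * e₁ = u₁ := by rw [hu₁, mul_assoc, he₁]
  have hu₁f : u₁ * f₁ = u₁ := by rw [hu₁, mul_assoc, hef₁]
  have hu₁f₂ : u₁ * f₂ = 0 := by rw [hu₁, mul_assoc, he₁f₂, mul_zero]
  have hv₁e : v₁ * e₁ = 0 := by rw [hv₁, mul_assoc, sub_mul, he₁, hfe₁, sub_self, mul_zero]
  have hv₁f : v₁ * f₁ = v₁ := by rw [hv₁, mul_assoc, sub_mul, hef₁, h₁₁]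
  have hv₁f₂ : v₁ * f₂ = 0 := by rw [← hv₁f, mul_assoc, h₁₂, mul_zero]
  have hxu₁ : f₁ * (x * u₁) = e₁ := by
    calc f₁ * (x * u₁) = f₁ * x * f₁ * r₁ * e₁ := by rw [hu₁]; simp only [mul_assoc]
      _ = e₁ := by rw [← hr₁, he₁]
  have hxv₁ : f₁ * ((f - x) * v₁) = f₁ - e₁ := by
    calc f₁ * ((f - x) * v₁) = (f₁ * f * f₁ - f₁ * x * f₁) * t₁ * (f₁ - e₁) := by
          rw [hv₁]; simp only [mul_assoc, mul_sub, sub_mul]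
      _ = f₁ - e₁ := by
          rw [hf₁f, h₁₁, ← ht₁, mul_sub, sub_mul, sub_mul, h₁₁, hef₁, hfe₁, he₁]; abel
  obtain ⟨w, hw⟩ : ∃ w, w = x * u₁ + (f - x) * v₁ := ⟨_, rfl⟩
  have hf₁w : f₁ * w = f₁ := by rw [hw, mul_add, hxu₁, hxv₁]; abel
  have hwf₁ : w * f₁ = w := by rw [hw, add_mul, mul_assoc, mul_assoc, hu₁f, hv₁f]
  have hwf₂ : w * f₂ = 0 := by rw [← hwf₁, mul_assoc, h₁₂, mul_zero]
  have hwe : w * e₁ = x * u₁ := by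
    rw [hw, add_mul, mul_assoc, mul_assoc, hu₁e, hv₁e, mul_zero, add_zero]
  have hww : w * w = w := by
    calc w * w = w * (f₁ * w) := by rw [← mul_assoc, hwf₁]
      _ = w := by rw [hf₁w, hwf₁]
  obtain ⟨q, hq⟩ : ∃ q, q = f₂ - f₂ * w := ⟨_, rfl⟩
  have hqw : q * w = 0 := by rw [hq, sub_mul, mul_assoc, hww, sub_self]
  have hqf₂ : q * f₂ = f₂ := by rw [hq, sub_mul, mul_assoc, hwf₂, h₂₂, mul_zero, sub_zero]
  have hf₂q : f₂ * q = q := by rw [hq, mul_sub, ← mul_assoc, h₂₂]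
  have hwf : w * f = w := by rw [hf, mul_add, hwf₁, hwf₂, add_zero]
  have hqf : q * f = q := by rw [hq, sub_mul, mul_assoc, hwf, hf₂f]
  have hqxu₁ : q * (x * u₁) = 0 := by rw [← hwe, ← mul_assoc, hqw, zero_mul]
  have hqxv₁ : q * ((f - x) * v₁) = 0 := by
    have : (f - x) * v₁ = w - x * u₁ := by rw [hw]; abel
    rw [this, mul_sub, hqw, hqxu₁, sub_zero]
  obtain ⟨e₂, r₂, t₂, he₂, hfe₂, hef₂, hr₂, ht₂⟩ := H₂ (q * x * f₂) (hJ x hx _ _)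
    (by simp only [← mul_assoc, hf₂q]) (by simp only [mul_assoc, h₂₂])
  obtain ⟨u₂, hu₂⟩ : ∃ u, u = f₂ * r₂ * e₂ := ⟨_, rfl⟩
  obtain ⟨v₂, hv₂⟩ : ∃ v, v = f₂ * t₂ * (f₂ - e₂) := ⟨_, rfl⟩
  have hf₁e₂ : f₁ * e₂ = 0 := by rw [← hfe₂, ← mul_assoc, h₁₂, zero_mul]
  have hf₂e₁ : f₂ * e₁ = 0 := by rw [← hfe₁, ← mul_assoc, h₂₁, zero_mul]
  have hu₂e : u₂ * e₂ = u₂ := by rw [hu₂, mul_assoc, he₂]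
  have hu₂f : u₂ * f₂ = u₂ := by rw [hu₂, mul_assoc, hef₂]
  have hu₂f₁ : u₂ * f₁ = 0 := by rw [← hu₂f, mul_assoc, h₂₁, mul_zero]
  have hu₂e₁ : u₂ * e₁ = 0 := by rw [← hu₂f, mul_assoc, hf₂e₁, mul_zero]
  have hu₁e₂ : u₁ * e₂ = 0 := by rw [← hu₁f, mul_assoc, hf₁e₂, mul_zero]
  have hv₂e : v₂ * e₂ = 0 := by rw [hv₂, mul_assoc, sub_mul, he₂, hfe₂, sub_self, mul_zero]
  have hv₂f : v₂ * f₂ = v₂ := by rw [hv₂, mul_assoc, sub_mul, hef₂, h₂₂]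
  have hv₂f₁ : v₂ * f₁ = 0 := by rw [← hv₂f, mul_assoc, h₂₁, mul_zero]
  have hv₂e₁ : v₂ * e₁ = 0 := by rw [← hv₂f, mul_assoc, hf₂e₁, mul_zero]
  have hv₁e₂ : v₁ * e₂ = 0 := by rw [← hv₁f, mul_assoc, hf₁e₂, mul_zero]
  have hqxu₂ : q * (x * u₂) = e₂ := by
    calc q * (x * u₂) = q * x * f₂ * r₂ * e₂ := by rw [hu₂]; simp only [mul_assoc]
      _ = e₂ := by rw [← hr₂, he₂]
  have hqxv₂ : q * ((f - x) * v₂) = f₂ - e₂ := by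
    calc q * ((f - x) * v₂) = (q * f * f₂ - q * x * f₂) * t₂ * (f₂ - e₂) := by
          rw [hv₂]; simp only [mul_assoc, mul_sub, sub_mul]
      _ = f₂ - e₂ := by
          rw [hqf, hqf₂, ← ht₂, mul_sub, sub_mul, sub_mul, h₂₂, hef₂, hfe₂, he₂]; abel
  obtain ⟨U, hU⟩ : ∃ U, U = u₁ + u₂ - u₁ * (x * u₂) := ⟨_, rfl⟩
  obtain ⟨V, hV⟩ : ∃ V, V = v₁ + v₂ - v₁ * ((f - x) * v₂) := ⟨_, rfl⟩
  obtain ⟨W, hW⟩ : ∃ W, W = x * U + (f - x) * V := ⟨_, rfl⟩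
  have hqU : q * (x * U) = e₂ := by
    calc q * (x * U) = q * (x * u₁) + q * (x * u₂) - q * (x * u₁) * (x * u₂) := by
          rw [hU]; simp only [mul_assoc, mul_add, mul_sub]
      _ = e₂ := by rw [hqxu₁, hqxu₂, zero_mul, zero_add, sub_zero]
  have hqV : q * ((f - x) * V) = f₂ - e₂ := by
    calc q * ((f - x) * V) = q * ((f - x) * v₁) + q * ((f - x) * v₂)
            - q * ((f - x) * v₁) * ((f - x) * v₂) := by
          rw [hV, mul_sub (f - x), mul_add (f - x), mul_sub q, mul_add q]
          simp only [mul_assoc]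
      _ = f₂ - e₂ := by rw [hqxv₁, hqxv₂, zero_mul, zero_add, sub_zero]
  have hqW : q * W = f₂ := by rw [hW, mul_add, hqU, hqV]; abel
  have hUf₁ : U * f₁ = u₁ := by
    rw [hU, sub_mul, add_mul, mul_assoc, mul_assoc, hu₂f₁, hu₁f]; simp
  have hVf₁ : V * f₁ = v₁ := by
    rw [hV, sub_mul, add_mul, mul_assoc, mul_assoc, hv₂f₁, hv₁f]; simp
  have hUf₂ : U * f₂ = U - u₁ := by
    rw [hU, sub_mul, add_mul, mul_assoc, mul_assoc, hu₂f, hu₁f₂]; abel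
  have hVf₂ : V * f₂ = V - v₁ := by
    rw [hV, sub_mul, add_mul, mul_assoc, mul_assoc, hv₂f, hv₁f₂]; abel
  have hWf₁ : W * f₁ = w := by rw [hW, add_mul, mul_assoc, mul_assoc, hUf₁, hVf₁, hw]
  have hfW : f * W = W := by
    rw [hW, mul_add, ← mul_assoc, ← mul_assoc, mul_sub, hff, hfx]
  have hWf : W * f = W := by
    rw [hf, mul_add, hWf₁, hW, add_mul, mul_assoc, mul_assoc, hUf₂, hVf₂, hw]
    simp only [mul_sub]; abel
  obtain ⟨k, hk⟩ : ∃ k, k = f₁ * W * f₂ := ⟨_, rfl⟩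
  obtain ⟨m, hm⟩ : ∃ m, m = f₂ * w := ⟨_, rfl⟩
  have hkk : k * k = 0 := by
    calc k * k = f₁ * W * (f₂ * f₁) * (W * f₂) := by rw [hk]; simp only [mul_assoc]
      _ = 0 := by rw [h₂₁, mul_zero, zero_mul]
  have hfk : f * k = k := by rw [hk, ← mul_assoc, ← mul_assoc, hff₁]
  have hkf : k * f = k := by rw [hk, mul_assoc, hf₂f]
  have hmm : m * m = 0 := by
    calc m * m = f₂ * (w * f₂) * w := by rw [hm]; simp only [mul_assoc]
      _ = 0 := by rw [hwf₂, mul_zero, zero_mul]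
  have hfm : f * m = m := by rw [hm, ← mul_assoc, hff₂]
  have hmf : m * f = m := by rw [hm, mul_assoc, hwf]
  have hf₁W : f₁ * W = f₁ + k := by
    calc f₁ * W = f₁ * (W * f₁) + f₁ * W * f₂ := by
          conv_lhs => rw [← hWf, hf]
          simp only [mul_add, mul_assoc]
      _ = f₁ + k := by rw [hWf₁, hf₁w, hk]
  have hmW : (f - m) * W = f + k := by
    have : f - m = f₁ + q := by rw [hf, hm, hq]; abel
    rw [this, add_mul, hqW, hf₁W, hf]; abel
  have hpm : (f + m) * (f - m) = f := by
    simp only [add_mul, mul_sub, hff, hfm, hmf, hmm]; abel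
  have hkp : (f + k) * (f - k) = f := by
    simp only [add_mul, mul_sub, hff, hfk, hkf, hkk]; abel
  have hkm : (f - k) * (f + k) = f := by
    simp only [sub_mul, mul_add, hff, hfk, hkf, hkk]; abel
  have hWfac : W = (f + m) * (f + k) := by
    rw [← hmW, ← mul_assoc, hpm, hfW]
  obtain ⟨L, hL⟩ : ∃ L, L = (f - k) * (f - m) := ⟨_, rfl⟩
  have hLW : L * W = f := by rw [hL, mul_assoc, hmW, hkm]
  have hWL : W * L = f := by
    calc W * L = (f + m) * ((f + k) * (f - k)) * (f - m) := by
          rw [hWfac, hL]; simp only [mul_assoc]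
      _ = f := by rw [hkp, add_mul, hff, hmf, hpm]
  have hLf : L * f = L := by rw [hL, mul_assoc, sub_mul f m f, hff, hmf]
  have hUe : U * (e₁ + e₂) = U := by
    rw [hU]
    simp only [mul_add, sub_mul, add_mul, mul_assoc, hu₁e, hu₂e, hu₂e₁, hu₁e₂, mul_zero]
    abel
  have hVe : V * (e₁ + e₂) = 0 := by
    rw [hV, sub_mul, add_mul, mul_assoc v₁, mul_assoc (f - x), mul_add v₁, mul_add v₂,
      hv₁e, hv₁e₂, hv₂e, hv₂e₁]
    simp
  have he₁₂ : e₁ * e₂ = 0 := by rw [← hef₁, mul_assoc, hf₁e₂, mul_zero]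
  have he₂₁ : e₂ * e₁ = 0 := by rw [← hef₂, mul_assoc, hf₂e₁, mul_zero]
  have hee : (e₁ + e₂) * (e₁ + e₂) = e₁ + e₂ := by
    simp only [add_mul, mul_add, he₁, he₂, he₁₂, he₂₁]; abel
  have hef : (e₁ + e₂) * f = e₁ + e₂ := by
    have : e₂ * f₁ = 0 := by rw [← hef₂, mul_assoc, h₂₁, mul_zero]
    rw [hf]; simp only [add_mul, mul_add, hef₁, hef₂, he₁f₂, this]; abel
  have hWe : W * (e₁ + e₂) = x * U := by
    rw [hW, add_mul, mul_assoc, mul_assoc, hUe, hVe, mul_zero, add_zero]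
  refine ⟨W * (e₁ + e₂) * L, U * L, V * L, ?_, ?_, ?_, ?_, ?_⟩
  · calc W * (e₁ + e₂) * L * (W * (e₁ + e₂) * L)
        = W * ((e₁ + e₂) * (L * W) * (e₁ + e₂)) * L := by simp only [mul_assoc]
      _ = _ := by rw [hLW, hef, hee]
  · rw [← mul_assoc, ← mul_assoc, hfW]
  · rw [mul_assoc, hLf]
  · rw [hWe, mul_assoc]
  · rw [hWe, ← mul_assoc, sub_eq_iff_eq_add, ← add_mul, add_comm, ← hW, hWL]

theorem IsCornerExchange.sum {T ι : Type*} [Ring T] {J : Set T}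
    (hJ : ∀ x ∈ J, ∀ a b, a * x * b ∈ J) {f : ι → T} (hf : ∀ i, f i * f i = f i)
    (hf' : ∀ i j, i ≠ j → f i * f j = 0) (H : ∀ i, IsCornerExchange J (f i)) (s : Finset ι) :
    IsCornerExchange J (∑ i ∈ s, f i) := by
  classical
  have hmul (s : Finset ι) : (∑ i ∈ s, f i) * (∑ i ∈ s, f i) = ∑ i ∈ s, f i := by
    rw [Finset.sum_mul_sum]
    refine Finset.sum_congr rfl fun i hi => ?_
    rw [Finset.sum_eq_single_of_mem i hi fun j _ hj => hf' i j hj.symm, hf]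
  induction s using Finset.induction_on with
  | empty =>
    intro x _ hx _
    exact ⟨0, 0, 0, by simp, by simp, by simp, by simp, by simp⟩
  | insert a s ha ih =>
    rw [Finset.sum_insert ha]
    refine IsCornerExchange.add hJ (hf a) (hmul s) ?_ ?_ (H a) ih
    · rw [Finset.mul_sum]
      exact Finset.sum_eq_zero fun i hi => hf' _ _ (by rintro rfl; exact ha hi)
    · rw [Finset.sum_mul]
      exact Finset.sum_eq_zero fun i hi => hf' _ _ (by rintro rfl; exact ha hi)

/-- The submodule `X·I` of a right module `X`. -/
def mulIdeal {R : Type*} [Ring R] (I : TwoSidedIdeal R)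
    (X : Type*) [AddCommGroup X] [Module Rᵐᵒᵖ X] : Submodule Rᵐᵒᵖ X :=
  Submodule.span Rᵐᵒᵖ {y : X | ∃ (x : X) (i : R), i ∈ I ∧ y = op i • x}

theorem map_mem_mulIdeal {R : Type*} [Ring R] (I : TwoSidedIdeal R)
    {X Y : Type*} [AddCommGroup X] [Module Rᵐᵒᵖ X] [AddCommGroup Y] [Module Rᵐᵒᵖ Y]
    (g : X →ₗ[Rᵐᵒᵖ] Y) {x : X} (hx : x ∈ mulIdeal I X) : g x ∈ mulIdeal I Y := by
  suffices mulIdeal I X ≤ (mulIdeal I Y).comap g from this hx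
  refine Submodule.span_le.2 ?_
  rintro _ ⟨x, i, hi, rfl⟩
  exact Submodule.subset_span ⟨g x, i, hi, map_smul _ _ _⟩

theorem unop_mem_of_mem_mulIdeal {R : Type*} [Ring R] (I : TwoSidedIdeal R)
    {x : Rᵐᵒᵖ} (hx : x ∈ mulIdeal I Rᵐᵒᵖ) : x.unop ∈ I := by
  induction hx using Submodule.span_induction with
  | mem y hy =>
    obtain ⟨y, i, hi, rfl⟩ := hy
    simpa using I.mul_mem_left _ _ hi
  | zero => exact I.zero_mem
  | add y z _ _ hy hz => exact I.add_mem hy hz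
  | smul a y _ hy => simpa using I.mul_mem_right _ _ hy

/-- Left multiplication by `a` on the `k`-th coordinate, and zero on the other ones. -/
def coordMul {R : Type*} [Ring R] {n : ℕ} (k : Fin n) (a : R) :
    Module.End Rᵐᵒᵖ (Fin n → Rᵐᵒᵖ) :=
  LinearMap.single Rᵐᵒᵖ (fun _ : Fin n => Rᵐᵒᵖ) k ∘ₗ
    LinearMap.toSpanSingleton Rᵐᵒᵖ Rᵐᵒᵖ (op a) ∘ₗ LinearMap.proj k

theorem coordMul_apply {R : Type*} [Ring R] {n : ℕ} (k : Fin n) (a : R) (v : Fin n → Rᵐᵒᵖ) :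
    coordMul k a v = Pi.single k (v k * op a) := by
  simp [coordMul]

theorem coordMul_mul {R : Type*} [Ring R] {n : ℕ} (k : Fin n) (a b : R) :
    coordMul k a * coordMul k b = coordMul k (a * b) := by
  refine LinearMap.ext fun v => ?_
  simp [coordMul_apply, mul_assoc]

theorem coordMul_sub {R : Type*} [Ring R] {n : ℕ} (k : Fin n) (a b : R) :
    coordMul k a - coordMul k b = coordMul k (a - b) := by
  refine LinearMap.ext fun v => ?_
  simp [coordMul_apply, mul_sub, Pi.single_sub]

theorem isCornerExchange_coordMul_one {R : Type*} [Ring R] {I : TwoSidedIdeal R}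
    (hI : IsExchangeIdeal I) {n : ℕ} (k : Fin n) :
    IsCornerExchange {φ : Module.End Rᵐᵒᵖ (Fin n → Rᵐᵒᵖ) | ∀ v, φ v ∈ mulIdeal I _}
      (coordMul k 1) := by
  intro x hx hkx hxk
  obtain ⟨a, ha⟩ : ∃ a, a = (x (Pi.single k 1) k).unop := ⟨_, rfl⟩
  have haI : a ∈ I := by
    rw [ha]
    exact unop_mem_of_mem_mulIdeal I (map_mem_mulIdeal I (LinearMap.proj k) (hx _))
  have hxa : x = coordMul k a := by
    refine LinearMap.ext fun v => ?_
    rw [← hkx, ← hxk]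
    have : (Pi.single k (v k) : Fin n → Rᵐᵒᵖ) = v k • Pi.single k 1 := by
      rw [← Pi.single_smul]; simp
    simp only [Module.End.mul_apply, coordMul_apply, ha, op_one, mul_one, this, map_smul,
      op_unop]
    rw [← Pi.single_smul, smul_eq_mul]
  obtain ⟨e, -, r, -, s, -, hee, her, hes⟩ := hI a haI
  refine ⟨coordMul k e, coordMul k r, coordMul k (1 - s), ?_, ?_, ?_, ?_, ?_⟩
  · rw [coordMul_mul, hee.eq]
  · rw [coordMul_mul, one_mul]
  · rw [coordMul_mul, mul_one]
  · rw [hxa, coordMul_mul, her]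
  · rw [hxa, coordMul_sub, coordMul_sub, coordMul_mul, hes]
    congr 1
    noncomm_ring

theorem exists_idempotent_of_fullOverIdeal {R : Type*} [Ring R] {I : TwoSidedIdeal R}
    (hI : IsExchangeIdeal I) {A : Type*} [AddCommGroup A] [Module Rᵐᵒᵖ A]
    [Module.Finite Rᵐᵒᵖ A] [Module.Projective Rᵐᵒᵖ A] (hA : FullOverIdeal I A)
    (x : Module.End Rᵐᵒᵖ A) :
    ∃ e r t : Module.End Rᵐᵒᵖ A, e * e = e ∧ e = x * r ∧ 1 - e = (1 - x) * t := by
  obtain ⟨n, p, hp⟩ := Module.Finite.exists_fin' Rᵐᵒᵖ A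
  obtain ⟨i, hi⟩ := Module.projective_lifting_property p LinearMap.id hp
  have hpi (a : A) : p (i a) = a := LinearMap.congr_fun hi a
  have hsum : ∑ k : Fin n, coordMul k (1 : R) = 1 := by
    refine LinearMap.ext fun v => ?_
    simp [LinearMap.sum_apply, coordMul_apply, Finset.univ_sum_single]
  have key := IsCornerExchange.sum
    (J := {φ : Module.End Rᵐᵒᵖ (Fin n → Rᵐᵒᵖ) | ∀ v, φ v ∈ mulIdeal I _})
    (fun y hy a b v => map_mem_mulIdeal I a (hy (b v)))
    (f := fun k => coordMul k (1 : R)) (fun k => by rw [coordMul_mul, one_mul])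
    (fun j k hjk => by
      refine LinearMap.ext fun v => ?_
      simp [coordMul_apply, hjk])
    (fun k => isCornerExchange_coordMul_one hI k) Finset.univ
  rw [hsum] at key
  have htop (a : A) : a ∈ mulIdeal I A := by
    have : mulIdeal I A = ⊤ := hA
    rw [this]; trivial
  obtain ⟨E, r, t, hE, -, -, hr, ht⟩ := key (i ∘ₗ x ∘ₗ p)
    (fun v => map_mem_mulIdeal I i (htop _)) (one_mul _) (mul_one _)
  have hEr (v) : E v = i (x (p (r v))) := LinearMap.congr_fun hr v
  have hEt (v) : v - E v = t v - i (x (p (t v))) := LinearMap.congr_fun ht v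
  have hEE (v) : E (E v) = E v := LinearMap.congr_fun hE v
  refine ⟨p ∘ₗ E ∘ₗ i, p ∘ₗ r ∘ₗ i, p ∘ₗ t ∘ₗ i, ?_, ?_, ?_⟩ <;>
    refine LinearMap.ext fun a => ?_
  · have : i (p (E (i a))) = E (i a) := by rw [hEr, hpi]
    simp [this, hEE]
  · simp [hEr, hpi]
  · have := congrArg p (hEt (i a))
    simpa [hpi] using this

theorem exists_refinement_of_fullOverIdeal {R : Type u} [Ring R] {I : TwoSidedIdeal R}
    (hI : IsExchangeIdeal I) (A B C D : Type v)
    [AddCommGroup A] [Module Rᵐᵒᵖ A] [Module.Finite Rᵐᵒᵖ A] [Module.Projective Rᵐᵒᵖ A]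
    [AddCommGroup B] [Module Rᵐᵒᵖ B] [AddCommGroup C] [Module Rᵐᵒᵖ C]
    [AddCommGroup D] [Module Rᵐᵒᵖ D]
    (iso : (A × B) ≃ₗ[Rᵐᵒᵖ] (C × D)) (hA : FullOverIdeal I A) :
    ∃ (Z₁₁ Z₂₁ : Submodule Rᵐᵒᵖ C) (Z₁₂ Z₂₂ : Submodule Rᵐᵒᵖ D),
      Nonempty (A ≃ₗ[Rᵐᵒᵖ] (Z₁₁ × Z₁₂)) ∧ Nonempty (B ≃ₗ[Rᵐᵒᵖ] (Z₂₁ × Z₂₂)) ∧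
      Nonempty (C ≃ₗ[Rᵐᵒᵖ] (Z₁₁ × Z₂₁)) ∧ Nonempty (D ≃ₗ[Rᵐᵒᵖ] (Z₁₂ × Z₂₂)) := by
  obtain ⟨γ, hγ⟩ : ∃ γ : C →ₗ[Rᵐᵒᵖ] A, ∀ c, γ c = (iso.symm (c, 0)).1 :=
    ⟨LinearMap.fst _ _ _ ∘ₗ iso.symm.toLinearMap ∘ₗ LinearMap.inl _ _ _, fun _ => rfl⟩
  obtain ⟨δ, hδ⟩ : ∃ δ : D →ₗ[Rᵐᵒᵖ] A, ∀ d, δ d = (iso.symm (0, d)).1 :=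
    ⟨LinearMap.fst _ _ _ ∘ₗ iso.symm.toLinearMap ∘ₗ LinearMap.inr _ _ _, fun _ => rfl⟩
  obtain ⟨α, hα⟩ : ∃ α : A →ₗ[Rᵐᵒᵖ] C, ∀ a, α a = (iso (a, 0)).1 :=
    ⟨LinearMap.fst _ _ _ ∘ₗ iso.toLinearMap ∘ₗ LinearMap.inl _ _ _, fun _ => rfl⟩
  obtain ⟨β, hβ⟩ : ∃ β : A →ₗ[Rᵐᵒᵖ] D, ∀ a, β a = (iso (a, 0)).2 :=
    ⟨LinearMap.snd _ _ _ ∘ₗ iso.toLinearMap ∘ₗ LinearMap.inl _ _ _, fun _ => rfl⟩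
  have hπ (c : C) (d : D) : (iso.symm (c, d)).1 = γ c + δ d := by
    rw [hγ, hδ, ← Prod.fst_add, ← map_add, Prod.mk_add_mk, add_zero, zero_add]
  have hsplit (a : A) : γ (α a) + δ (β a) = a := by
    rw [← hπ, hα, hβ, Prod.mk.eta, LinearEquiv.symm_apply_apply]
  obtain ⟨e, r, t, he, hr, ht⟩ := exists_idempotent_of_fullOverIdeal hI hA (γ ∘ₗ α)
  have hee (a : A) : e (e a) = e a := LinearMap.congr_fun he a
  have her (a : A) : e a = γ (α (r a)) := LinearMap.congr_fun hr a
  have het (a : A) : a - e a = δ (β (t a)) := by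
    have := LinearMap.congr_fun ht a
    have h2 : a - e a = t a - γ (α (t a)) := this
    rw [h2, sub_eq_iff_eq_add', hsplit]
  obtain ⟨u, hu⟩ : ∃ u : A →ₗ[Rᵐᵒᵖ] C, ∀ a, u a = α (r (e a)) :=
    ⟨α ∘ₗ r ∘ₗ e, fun _ => rfl⟩
  obtain ⟨v, hv⟩ : ∃ v : A →ₗ[Rᵐᵒᵖ] D, ∀ a, v a = β (t (a - e a)) :=
    ⟨β ∘ₗ t ∘ₗ (LinearMap.id - e), fun _ => rfl⟩
  have hγu (a : A) : γ (u a) = e a := by rw [hu, ← her, hee]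
  have hδv (a : A) : δ (v a) = a - e a := by rw [hv, ← het]; simp [hee]
  have hue (a : A) : u (e a) = u a := by rw [hu, hu, hee]
  have hve (a : A) : v (e a) = 0 := by rw [hv, hee, sub_self, map_zero, map_zero]
  obtain ⟨δ', hδ'⟩ : ∃ δ' : D →ₗ[Rᵐᵒᵖ] A, ∀ d, δ' d = δ d - e (δ d) :=
    ⟨δ - e ∘ₗ δ, fun _ => rfl⟩
  have hC : IsCompl (LinearMap.range u) (LinearMap.ker (e ∘ₗ γ)) := by
    constructor
    · rw [Submodule.disjoint_def]
      rintro _ ⟨a, rfl⟩ h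
      have h' : e (γ (u a)) = 0 := h
      rw [hγu, hee] at h'
      rw [← hue, h', map_zero]
    · rw [codisjoint_iff, eq_top_iff]
      intro c _
      refine Submodule.mem_sup.2 ⟨u (γ c), ⟨_, rfl⟩, c - u (γ c), ?_, by abel⟩
      simp [hγu, hee]
  have hD : IsCompl (LinearMap.range v) (LinearMap.ker δ') := by
    constructor
    · rw [Submodule.disjoint_def]
      rintro _ ⟨a, rfl⟩ h
      have h' : δ' (v a) = 0 := h
      rw [hδ', hδv, map_sub, hee, sub_self, sub_zero] at h'
      have := congrArg v h'
      rwa [map_sub, hve, sub_zero, map_zero] at this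
    · rw [codisjoint_iff, eq_top_iff]
      intro d _
      refine Submodule.mem_sup.2 ⟨v (δ d), ⟨_, rfl⟩, d - v (δ d), ?_, by abel⟩
      simp [hδ', hδv, hee]
  refine ⟨LinearMap.range u, LinearMap.ker (e ∘ₗ γ), LinearMap.range v, LinearMap.ker δ',
    ⟨LinearEquiv.ofBijective (u.rangeRestrict.prod v.rangeRestrict) ⟨?_, ?_⟩⟩, ?_,
    ⟨(Submodule.prodEquivOfIsCompl _ _ hC).symm⟩, ⟨(Submodule.prodEquivOfIsCompl _ _ hD).symm⟩⟩
  · rw [injective_iff_map_eq_zero]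
    intro a ha
    have h1 : u a = 0 := congrArg (fun z => (z.1 : C)) ha
    have h2 : v a = 0 := congrArg (fun z => (z.2 : D)) ha
    have h3 := hγu a
    have h4 := hδv a
    rw [h1, map_zero] at h3
    rw [h2, map_zero, ← h3, sub_zero] at h4
    exact h4.symm
  · rintro ⟨⟨_, a, rfl⟩, ⟨_, b, rfl⟩⟩
    refine ⟨e a + (b - e b), Prod.ext (Subtype.ext ?_) (Subtype.ext ?_)⟩
    · change u _ = u a
      simp [hue]
    · change v _ = v b
      simp [hve]
  · let g : B →ₗ[Rᵐᵒᵖ] C × D := iso.toLinearMap ∘ₗ LinearMap.inr _ _ _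
    have hg (b : B) : γ (g b).1 + δ (g b).2 = 0 := by
      rw [← hπ]
      simp [g]
    have hginj : Function.Injective g := iso.injective.comp LinearMap.inr_injective
    let g₁ : B →ₗ[Rᵐᵒᵖ] LinearMap.ker (e ∘ₗ γ) :=
      LinearMap.codRestrict _ ((LinearMap.id - u ∘ₗ γ) ∘ₗ LinearMap.fst _ _ _ ∘ₗ g)
        (fun b => by simp [hγu, hee])
    let g₂ : B →ₗ[Rᵐᵒᵖ] LinearMap.ker δ' :=
      LinearMap.codRestrict _ ((LinearMap.id - v ∘ₗ δ) ∘ₗ LinearMap.snd _ _ _ ∘ₗ g)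
        (fun b => by simp [hδ', hδv, hee])
    refine ⟨LinearEquiv.ofBijective (g₁.prod g₂) ⟨?_, ?_⟩⟩
    · rw [injective_iff_map_eq_zero]
      intro b hb
      have h1 : (g b).1 - u (γ (g b).1) = 0 := congrArg (fun z => (z.1 : C)) hb
      have h2 : (g b).2 - v (δ (g b).2) = 0 := congrArg (fun z => (z.2 : D)) hb
      rw [sub_eq_zero] at h1 h2
      have h3 : γ (g b).1 = e (γ (g b).1) := by
        conv_lhs => rw [h1, hγu]
      have h4 : e (δ (g b).2) = 0 := by
        have := congrArg δ h2
        rw [hδv] at this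
        exact sub_eq_self.1 this.symm
      have h5 : γ (g b).1 = 0 := by
        rw [h3, eq_neg_of_add_eq_zero_left (hg b), map_neg, h4, neg_zero]
      have h6 : δ (g b).2 = 0 := by simpa [h5] using hg b
      refine hginj ?_
      rw [map_zero]
      refine Prod.ext ?_ ?_
      · rw [h1, h5, map_zero]; rfl
      · rw [h2, h6, map_zero]; rfl
    · rintro ⟨⟨c, hc⟩, ⟨d, hd⟩⟩
      have hc' : e (γ c) = 0 := hc
      have hd' : δ d - e (δ d) = 0 := by rw [← hδ']; exact hd
      have hd'' : e (δ d) = δ d := (sub_eq_zero.1 hd').symm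
      obtain ⟨z, hz⟩ : ∃ z : C × D, z = (c - u (δ d), d - v (γ c)) := ⟨_, rfl⟩
      have hz1 : (iso.symm z).1 = 0 := by
        rw [hz, hπ, map_sub, map_sub, hγu, hδv, hc', hd'']
        abel
      have hgz : g (iso.symm z).2 = z := by
        have : ((0 : A), (iso.symm z).2) = iso.symm z := Prod.ext hz1.symm rfl
        change iso ((0 : A), (iso.symm z).2) = z
        rw [this, LinearEquiv.apply_symm_apply]
      refine ⟨(iso.symm z).2, Prod.ext (Subtype.ext ?_) (Subtype.ext ?_)⟩
      · change (g _).1 - u (γ (g _).1) = c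
        have h0 : u (γ c) = 0 := by rw [← hue, hc', map_zero]
        rw [hgz, hz]
        simp [hγu, hue, h0]
      · change (g _).2 - v (δ (g _).2) = d
        have h0 : v (δ d) = 0 := by rw [← hd'', hve]
        rw [hgz, hz]
        simp [hδv, hve, h0]

/-- If `I` is an exchange ideal of a unital ring `R` and `A, B, C, D` are
finitely generated projective right `R`-modules with `A ⊕ B ≅ C ⊕ D` such that at least one
of them `X` satisfies `X·I = X`, then there is a refinement: modules `Z₁₁, Z₁₂, Z₂₁, Z₂₂`
with `A ≅ Z₁₁ ⊕ Z₁₂`, `B ≅ Z₂₁ ⊕ Z₂₂`, `C ≅ Z₁₁ ⊕ Z₂₁`, `D ≅ Z₁₂ ⊕ Z₂₂`. -/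
theorem lifting_units_stmt0 {R : Type u} [Ring R] (I : TwoSidedIdeal R)
    (hI : IsExchangeIdeal I)
    (A B C D : Type v)
    [AddCommGroup A] [Module Rᵐᵒᵖ A] [Module.Finite Rᵐᵒᵖ A] [Module.Projective Rᵐᵒᵖ A]
    [AddCommGroup B] [Module Rᵐᵒᵖ B] [Module.Finite Rᵐᵒᵖ B] [Module.Projective Rᵐᵒᵖ B]
    [AddCommGroup C] [Module Rᵐᵒᵖ C] [Module.Finite Rᵐᵒᵖ C] [Module.Projective Rᵐᵒᵖ C]
    [AddCommGroup D] [Module Rᵐᵒᵖ D] [Module.Finite Rᵐᵒᵖ D] [Module.Projective Rᵐᵒᵖ D]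
    (iso : (A × B) ≃ₗ[Rᵐᵒᵖ] (C × D))
    (hfull : FullOverIdeal I A ∨ FullOverIdeal I B ∨ FullOverIdeal I C ∨ FullOverIdeal I D) :
    ∃ (Z₁₁ Z₁₂ Z₂₁ Z₂₂ : Type v)
      (_ : AddCommGroup Z₁₁) (_ : AddCommGroup Z₁₂)
      (_ : AddCommGroup Z₂₁) (_ : AddCommGroup Z₂₂)
      (_ : Module Rᵐᵒᵖ Z₁₁) (_ : Module Rᵐᵒᵖ Z₁₂)
      (_ : Module Rᵐᵒᵖ Z₂₁) (_ : Module Rᵐᵒᵖ Z₂₂),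
      Nonempty (A ≃ₗ[Rᵐᵒᵖ] (Z₁₁ × Z₁₂)) ∧ Nonempty (B ≃ₗ[Rᵐᵒᵖ] (Z₂₁ × Z₂₂)) ∧
      Nonempty (C ≃ₗ[Rᵐᵒᵖ] (Z₁₁ × Z₂₁)) ∧ Nonempty (D ≃ₗ[Rᵐᵒᵖ] (Z₁₂ × Z₂₂)) := by
  rcases hfull with h | h | h | h
  · obtain ⟨Z₁₁, Z₂₁, Z₁₂, Z₂₂, ⟨a⟩, ⟨b⟩, ⟨c⟩, ⟨d⟩⟩ :=
      exists_refinement_of_fullOverIdeal hI A B C D iso h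
    exact ⟨Z₁₁, Z₁₂, Z₂₁, Z₂₂, inferInstance, inferInstance, inferInstance, inferInstance,
      inferInstance, inferInstance, inferInstance, inferInstance, ⟨a⟩, ⟨b⟩, ⟨c⟩, ⟨d⟩⟩
  · obtain ⟨Z₁₁, Z₂₁, Z₁₂, Z₂₂, ⟨b⟩, ⟨a⟩, ⟨c⟩, ⟨d⟩⟩ :=
      exists_refinement_of_fullOverIdeal hI B A C D
        ((LinearEquiv.prodComm Rᵐᵒᵖ B A).trans iso) h
    exact ⟨Z₂₁, Z₂₂, Z₁₁, Z₁₂, inferInstance, inferInstance, inferInstance, inferInstance,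
      inferInstance, inferInstance, inferInstance, inferInstance, ⟨a⟩, ⟨b⟩,
      ⟨c.trans (LinearEquiv.prodComm _ _ _)⟩, ⟨d.trans (LinearEquiv.prodComm _ _ _)⟩⟩
  · obtain ⟨Z₁₁, Z₂₁, Z₁₂, Z₂₂, ⟨c⟩, ⟨d⟩, ⟨a⟩, ⟨b⟩⟩ :=
      exists_refinement_of_fullOverIdeal hI C D A B iso.symm h
    exact ⟨Z₁₁, Z₂₁, Z₁₂, Z₂₂, inferInstance, inferInstance, inferInstance, inferInstance,
      inferInstance, inferInstance, inferInstance, inferInstance, ⟨a⟩, ⟨b⟩, ⟨c⟩, ⟨d⟩⟩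
  · obtain ⟨Z₁₁, Z₂₁, Z₁₂, Z₂₂, ⟨d⟩, ⟨c⟩, ⟨a⟩, ⟨b⟩⟩ :=
      exists_refinement_of_fullOverIdeal hI D C A B
        ((LinearEquiv.prodComm Rᵐᵒᵖ D C).trans iso.symm) h
    exact ⟨Z₂₁, Z₁₁, Z₂₂, Z₁₂, inferInstance, inferInstance, inferInstance, inferInstance,
      inferInstance, inferInstance, inferInstance, inferInstance,
      ⟨a.trans (LinearEquiv.prodComm _ _ _)⟩, ⟨b.trans (LinearEquiv.prodComm _ _ _)⟩,
      ⟨c⟩, ⟨d⟩⟩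
end

section
/- Let M be an abelian monoid and let S be a separative order-ideal of M such that M has refinement with respect to S. If a + e = b + e for some a, b ∈ M and e ∈ S with e ≤ n·a and e ≤ n·b for some positive integer n, then a = b. -/
section Cancellation

variable {M : Type*} [AddCommMonoid M]

/-- The refinement property of `M` with respect to a submonoid `S`. -/
def RefinesOver (S : AddSubmonoid M) : Prop :=
  ∀ x₁ x₂ y₁ y₂ : M, x₁ + x₂ = y₁ + y₂ →
    (x₁ ∈ S ∨ x₂ ∈ S ∨ y₁ ∈ S ∨ y₂ ∈ S) →
    ∃ z₁₁ z₁₂ z₂₁ z₂₂ : M,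
      x₁ = z₁₁ + z₁₂ ∧ x₂ = z₂₁ + z₂₂ ∧ y₁ = z₁₁ + z₂₁ ∧ y₂ = z₁₂ + z₂₂

/-- Separativity of a submonoid `S`. -/
def SeparativeOn (S : AddSubmonoid M) : Prop :=
  ∀ a b : M, a ∈ S → b ∈ S → a + a = a + b → a + b = b + b → a = b

/-- `S` is an order-ideal for the algebraic preorder. -/
def IsOrderIdeal (S : AddSubmonoid M) : Prop :=
  ∀ x y : M, (∃ z, x + z = y) → y ∈ S → x ∈ S

variable {S : AddSubmonoid M}

theorem IsOrderIdeal.left_mem (hS : IsOrderIdeal S) {x y : M} (h : x + y ∈ S) : x ∈ S :=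
  hS x _ ⟨y, rfl⟩ h

theorem IsOrderIdeal.right_mem (hS : IsOrderIdeal S) {x y : M} (h : x + y ∈ S) : y ∈ S :=
  hS y _ ⟨x, add_comm y x⟩ h

/-- Riesz decomposition for elements of `S`. -/
theorem RefinesOver.exists_decomposition (href : RefinesOver S) {e x y : M} (he : e ∈ S)
    (h : ∃ z, e + z = x + y) :
    ∃ u v, e = u + v ∧ (∃ z, u + z = x) ∧ ∃ z, v + z = y := by
  obtain ⟨z, hz⟩ := h
  obtain ⟨p, q, r, s, h₁, -, h₃, h₄⟩ := href e z x y hz (Or.inl he)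
  exact ⟨p, q, h₁, ⟨r, h₃.symm⟩, ⟨s, h₄.symm⟩⟩

theorem SeparativeOn.cancel (hsep : SeparativeOn S) {a b c : M} (ha : a ∈ S) (hb : b ∈ S)
    (h : a + c = b + c) (hca : ∃ z, c + z = a) (hcb : ∃ z, c + z = b) : a = b := by
  obtain ⟨x, rfl⟩ := hca
  obtain ⟨y, rfl⟩ := hcb
  refine hsep _ _ ha hb ?_ ?_
  · calc c + x + (c + x) = c + x + c + x := by abel
      _ = c + y + c + x := by rw [h]
      _ = c + x + (c + y) := by abel
  · calc c + x + (c + y) = c + x + c + y := by abel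
      _ = c + y + c + y := by rw [h]
      _ = c + y + (c + y) := by abel

theorem cancel_of_le (hS : IsOrderIdeal S) (hsep : SeparativeOn S) (href : RefinesOver S)
    {a b e : M} (he : e ∈ S) (heq : a + e = b + e)
    (hea : ∃ z, e + z = a) (heb : ∃ z, e + z = b) : a = b := by
  obtain ⟨d, a₁, b₁, c, rfl, h₂, rfl, h₄⟩ := href a e b e heq (Or.inr (Or.inl he))
  have hbc : b₁ + c ∈ S := h₂ ▸ he
  have hac : a₁ + c ∈ S := h₄ ▸ he
  have hcS : c ∈ S := hS.right_mem hac
  obtain ⟨t, ht⟩ := hea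
  obtain ⟨t', ht'⟩ := heb
  obtain ⟨u, v, rfl, ⟨d', rfl⟩, hv⟩ := href.exists_decomposition (x := d) (y := a₁) hcS
    ⟨b₁ + t, by rw [← ht, h₂]; abel⟩
  obtain ⟨u', v', rfl, ⟨d'', rfl⟩, hv'⟩ := href.exists_decomposition
    (x := d') (y := u + b₁) (hS.right_mem hcS)
    ⟨u + a₁ + t', by
      calc v + (u + a₁ + t') = a₁ + (u + v) + t' := by abel
        _ = d' + (u + b₁) := by rw [← h₄, ht']; abel⟩
  obtain ⟨w, rfl⟩ := hv
  obtain ⟨w', hw'⟩ := hv'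
  have key : u' + v' + w + u + u' = b₁ + u + u' := by
    refine hsep.cancel (c := v') ?_ ?_ ?_ ⟨u' + w + u + u', by abel⟩
      ⟨w' + u', by rw [← add_assoc, hw']; abel⟩
    · exact hS.left_mem (y := v') (by convert hac using 1; abel)
    · exact hS.left_mem (y := v') (by convert hbc using 1; abel)
    · calc u' + v' + w + u + u' + v' = u' + v' + w + (u + (u' + v')) := by abel
        _ = b₁ + (u + (u' + v')) := h₄.symm.trans h₂
        _ = b₁ + u + u' + v' := by abel
  calc u + (u' + d'') + (u' + v' + w) = d'' + (u' + v' + w + u + u') := by abel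
    _ = d'' + (b₁ + u + u') := by rw [key]
    _ = u + (u' + d'') + b₁ := by abel

theorem cancel_of_le_nsmul_of_le (hS : IsOrderIdeal S) (hsep : SeparativeOn S)
    (href : RefinesOver S) (n : ℕ) {a b e : M} (he : e ∈ S) (heq : a + e = b + e)
    (hea : ∃ z, e + z = n • a) (heb : ∃ z, e + z = b) : a = b := by
  induction n generalizing a b e with
  | zero =>
    obtain ⟨z, hz⟩ := hea
    rw [zero_nsmul] at hz
    simpa [add_assoc, hz] using congrArg (· + z) heq
  | succ n ih =>
    rw [succ_nsmul] at hea
    obtain ⟨u, v, rfl, ⟨z, hz⟩, t, ht⟩ := href.exists_decomposition he hea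
    obtain ⟨w, rfl⟩ := heb
    refine cancel_of_le hS hsep href (hS.right_mem he) ?_ ⟨t, ht⟩ ⟨u + w, by abel⟩
    refine ih (hS.left_mem he) (by convert heq using 1 <;> abel)
      ⟨z + n • v, by rw [nsmul_add, ← hz]; abel⟩ ⟨v + w + v, by abel⟩

theorem cancel_of_le_nsmul (hS : IsOrderIdeal S) (hsep : SeparativeOn S)
    (href : RefinesOver S) (m n : ℕ) {a b e : M} (he : e ∈ S) (heq : a + e = b + e)
    (hea : ∃ z, e + z = m • a) (heb : ∃ z, e + z = n • b) : a = b := by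
  induction n generalizing a b e with
  | zero =>
    obtain ⟨z, hz⟩ := heb
    rw [zero_nsmul] at hz
    simpa [add_assoc, hz] using congrArg (· + z) heq
  | succ n ih =>
    rw [succ_nsmul] at heb
    obtain ⟨u, v, rfl, ⟨z, hz⟩, hv⟩ := href.exists_decomposition he heb
    obtain ⟨w, hw⟩ := hea
    refine cancel_of_le_nsmul_of_le hS hsep href m (hS.right_mem he) ?_
      ⟨u + w, by rw [← hw]; abel⟩ hv
    refine ih (hS.left_mem he) (by convert heq using 1 <;> abel)
      ⟨v + w + m • v, by rw [nsmul_add, ← hw]; abel⟩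
      ⟨z + n • v, by rw [nsmul_add, ← hz]; abel⟩

end Cancellation


/-- Let `M` be an abelian monoid and `S` a separative order-ideal of `M`
such that `M` has refinement with respect to `S`.  If `a + e = b + e` with `e ∈ S` and
`e ≤ n • a`, `e ≤ n • b` for some positive integer `n`, then `a = b`.  Here `x ≤ y` is the
algebraic order: `∃ z, x + z = y`. -/
theorem lifting_units_stmt1 {M : Type*} [AddCommMonoid M] (S : AddSubmonoid M)
    (horder : ∀ x y : M, (∃ z, x + z = y) → y ∈ S → x ∈ S)
    (hsep : ∀ a b : M, a ∈ S → b ∈ S → a + a = a + b → a + b = b + b → a = b)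
    (href : ∀ x₁ x₂ y₁ y₂ : M, x₁ + x₂ = y₁ + y₂ →
      (x₁ ∈ S ∨ x₂ ∈ S ∨ y₁ ∈ S ∨ y₂ ∈ S) →
      ∃ z₁₁ z₁₂ z₂₁ z₂₂ : M,
        x₁ = z₁₁ + z₁₂ ∧ x₂ = z₂₁ + z₂₂ ∧ y₁ = z₁₁ + z₂₁ ∧ y₂ = z₁₂ + z₂₂)
    (a b e : M) (he : e ∈ S) (heq : a + e = b + e)
    (n : ℕ) (hn : 0 < n)
    (hea : ∃ z, e + z = n • a) (heb : ∃ z, e + z = n • b) :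
    a = b := by
  exact cancel_of_le_nsmul horder hsep href n n he heq hea heb
end

section
/- Let R be a unital ring and let I be a separative exchange ideal of R. Let d ∈ I and suppose there are idempotents p, q ∈ R with 1 − p ∈ I and 1 − q ∈ I such that dR = (1 − p)R and Rd = R(1 − q) (equality of right, respectively left, ideals). If RpR = R and RqR = R (the two-sided ideals generated by p and by q are all of R), then p and q are equivalent idempotents, i.e. there exist x, y ∈ R with xy = p and yx = q; in particular d is unit-regular, i.e. there exists a unit u ∈ R with d = d·u·d. -/
/-- Equivalence of (idempotent) matrices `e`, `f` of possibly different sizes: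
there are rectangular matrices `x`, `y` with `x * y = e` and `y * x = f`. -/
def MatEquiv {R : Type*} [Ring R] {n m : Type*} [Fintype n] [Fintype m]
    (e : Matrix n n R) (f : Matrix m m R) : Prop :=
  ∃ (x : Matrix n m R) (y : Matrix m n R), x * y = e ∧ y * x = f

/-- `I` is *separative* if for all idempotent matrices `e`, `f` with entries in `I`,
`e ⊕ e ∼ e ⊕ f` and `e ⊕ f ∼ f ⊕ f` imply `e ∼ f`. -/
def IsSeparativeIdeal {R : Type*} [Ring R] (I : TwoSidedIdeal R) : Prop :=
  ∀ (n m : ℕ) (e : Matrix (Fin n) (Fin n) R) (f : Matrix (Fin m) (Fin m) R),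
    IsIdempotentElem e → IsIdempotentElem f →
    (∀ i j, e i j ∈ I) → (∀ i j, f i j ∈ I) →
    MatEquiv (Matrix.fromBlocks e 0 0 e) (Matrix.fromBlocks e 0 0 f) →
    MatEquiv (Matrix.fromBlocks e 0 0 f) (Matrix.fromBlocks f 0 0 f) →
    MatEquiv e f

/-! ### Equivalence of idempotent matrices -/

namespace MatEquiv

variable {R : Type*} [Ring R] {m n k l : Type*} [Fintype m] [Fintype n] [Fintype k] [Fintype l]

theorem symm {e : Matrix n n R} {f : Matrix m m R} (h : MatEquiv e f) : MatEquiv f e := by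
  obtain ⟨x, y, h₁, h₂⟩ := h
  exact ⟨y, x, h₂, h₁⟩

theorem refl {e : Matrix n n R} (he : IsIdempotentElem e) : MatEquiv e e := ⟨e, e, he, he⟩

theorem trans {e : Matrix n n R} {f : Matrix m m R} {g : Matrix k k R}
    (he : IsIdempotentElem e) (hg : IsIdempotentElem g)
    (h : MatEquiv e f) (h' : MatEquiv f g) : MatEquiv e g := by
  obtain ⟨x, y, rfl, rfl⟩ := h
  obtain ⟨z, w, h₁, rfl⟩ := h'
  refine ⟨x * z, w * y, ?_, ?_⟩
  · calc x * z * (w * y) = x * (z * w) * y := by simp only [Matrix.mul_assoc]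
      _ = x * y * (x * y) := by rw [h₁]; simp only [Matrix.mul_assoc]
      _ = x * y := he
  · calc w * y * (x * z) = w * (y * x) * z := by simp only [Matrix.mul_assoc]
      _ = w * z * (w * z) := by rw [← h₁]; simp only [Matrix.mul_assoc]
      _ = w * z := hg

theorem submatrix {e : Matrix n n R} (he : IsIdempotentElem e) (σ : m ≃ n) :
    MatEquiv e (e.submatrix σ σ) := by
  refine ⟨e.submatrix id σ, e.submatrix σ id, ?_, ?_⟩
  · rw [Matrix.submatrix_mul_equiv, he.eq, Matrix.submatrix_id_id]
  · rw [← Matrix.submatrix_mul _ _ _ _ _ Function.bijective_id, he.eq]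

theorem fromBlocks {e : Matrix n n R} {f : Matrix m m R} {e' : Matrix k k R} {f' : Matrix l l R}
    (h : MatEquiv e e') (h' : MatEquiv f f') :
    MatEquiv (Matrix.fromBlocks e 0 0 f) (Matrix.fromBlocks e' 0 0 f') := by
  obtain ⟨x, y, rfl, rfl⟩ := h
  obtain ⟨z, w, rfl, rfl⟩ := h'
  exact ⟨Matrix.fromBlocks x 0 0 z, Matrix.fromBlocks y 0 0 w, by
    simp [Matrix.fromBlocks_multiply], by simp [Matrix.fromBlocks_multiply]⟩

end MatEquiv

theorem IsIdempotentElem.fromBlocks {R : Type*} [Ring R] {m n : Type*} [Fintype m] [Fintype n]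
    {e : Matrix n n R} {f : Matrix m m R} (he : IsIdempotentElem e) (hf : IsIdempotentElem f) :
    IsIdempotentElem (Matrix.fromBlocks e 0 0 f) := by
  simp [IsIdempotentElem, Matrix.fromBlocks_multiply, he.eq, hf.eq]

/-! ### The monoid of equivalence classes of idempotent matrices -/

/-- An idempotent matrix over `R` indexed by some finite type. -/
structure IdemMatrix (R : Type*) [Ring R] where
  index : Type
  [fintype : Fintype index]
  mat : Matrix index index R
  idem : IsIdempotentElem mat

attribute [instance] IdemMatrix.fintype

instance IdemMatrix.setoid (R : Type*) [Ring R] : Setoid (IdemMatrix R) where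
  r e f := MatEquiv e.mat f.mat
  iseqv := ⟨fun e => .refl e.idem, fun h => h.symm, fun {e _ g} h h' => h.trans e.idem g.idem h'⟩

/-- The monoid of equivalence classes of idempotent matrices over `R`. -/
def IdemClass (R : Type*) [Ring R] := Quotient (IdemMatrix.setoid R)

namespace IdemClass

variable {R : Type*} [Ring R]

/-- The class of an idempotent matrix. -/
def mk {n : Type} [Fintype n] (e : Matrix n n R) (he : IsIdempotentElem e) : IdemClass R :=
  Quotient.mk _ ⟨n, e, he⟩

theorem mk_eq_mk {n m : Type} [Fintype n] [Fintype m] {e : Matrix n n R} {f : Matrix m m R}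
    {he : IsIdempotentElem e} {hf : IsIdempotentElem f} : mk e he = mk f hf ↔ MatEquiv e f :=
  Quotient.eq

theorem exists_mk (α : IdemClass R) :
    ∃ (n : Type) (_ : Fintype n) (e : Matrix n n R) (he : IsIdempotentElem e), mk e he = α := by
  induction α using Quotient.inductionOn with
  | h e => exact ⟨e.index, e.fintype, e.mat, e.idem, rfl⟩

instance : Add (IdemClass R) where
  add := Quotient.map₂
    (fun e f => ⟨e.index ⊕ f.index, Matrix.fromBlocks e.mat 0 0 f.mat, e.idem.fromBlocks f.idem⟩)
    (fun _ _ h _ _ h' => h.fromBlocks h')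

instance : Zero (IdemClass R) where
  zero := mk (0 : Matrix Empty Empty R) (.zero)

theorem mk_add_mk {n m : Type} [Fintype n] [Fintype m] {e : Matrix n n R} {f : Matrix m m R}
    (he : IsIdempotentElem e) (hf : IsIdempotentElem f) :
    mk e he + mk f hf = mk (Matrix.fromBlocks e 0 0 f) (he.fromBlocks hf) := rfl

theorem mk_eq_mk_of_submatrix {n m : Type} [Fintype n] [Fintype m]
    {e : Matrix n n R} {f : Matrix m m R}
    {he : IsIdempotentElem e} {hf : IsIdempotentElem f} (σ : m ≃ n) (h : e.submatrix σ σ = f) :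
    mk e he = mk f hf :=
  mk_eq_mk.2 (h ▸ .submatrix he σ)

protected theorem add_comm (α β : IdemClass R) : α + β = β + α := by
  obtain ⟨n, _, e, he, rfl⟩ := exists_mk α
  obtain ⟨m, _, f, hf, rfl⟩ := exists_mk β
  rw [mk_add_mk, mk_add_mk]
  refine mk_eq_mk_of_submatrix (Equiv.sumComm m n) ?_
  ext (i | i) (j | j) <;> rfl

protected theorem zero_add (α : IdemClass R) : 0 + α = α := by
  obtain ⟨n, _, e, he, rfl⟩ := exists_mk α
  refine mk_eq_mk_of_submatrix (Equiv.emptySum Empty n).symm ?_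
  ext i j
  rfl

protected theorem add_assoc (α β γ : IdemClass R) : α + β + γ = α + (β + γ) := by
  obtain ⟨n, _, e, he, rfl⟩ := exists_mk α
  obtain ⟨m, _, f, hf, rfl⟩ := exists_mk β
  obtain ⟨k, _, g, hg, rfl⟩ := exists_mk γ
  simp only [mk_add_mk]
  refine mk_eq_mk_of_submatrix (Equiv.sumAssoc n m k).symm ?_
  ext (i | i | i) (j | j | j) <;> rfl

instance : AddCommMonoid (IdemClass R) where
  add_assoc := IdemClass.add_assoc
  zero_add := IdemClass.zero_add
  add_zero α := by rw [IdemClass.add_comm, IdemClass.zero_add]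
  add_comm := IdemClass.add_comm
  nsmul := nsmulRec

/-- The classes of idempotent matrices with entries in `I`. -/
def ofIdeal (I : TwoSidedIdeal R) : AddSubmonoid (IdemClass R) where
  carrier := {α | ∃ (n : Type) (_ : Fintype n) (e : Matrix n n R) (he : IsIdempotentElem e),
    (∀ i j, e i j ∈ I) ∧ mk e he = α}
  zero_mem' := ⟨Empty, inferInstance, 0, .zero, fun i => i.elim, rfl⟩
  add_mem' := by
    rintro _ _ ⟨n, _, e, he, heI, rfl⟩ ⟨m, _, f, hf, hfI, rfl⟩
    refine ⟨n ⊕ m, inferInstance, _, he.fromBlocks hf, ?_, (mk_add_mk he hf).symm⟩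
    rintro (i | i) (j | j)
    · exact heI i j
    · exact I.zero_mem
    · exact I.zero_mem
    · exact hfI i j

theorem exists_fin_of_mem_ofIdeal {I : TwoSidedIdeal R} {α : IdemClass R} (hα : α ∈ ofIdeal I) :
    ∃ (n : ℕ) (e : Matrix (Fin n) (Fin n) R) (he : IsIdempotentElem e),
      (∀ i j, e i j ∈ I) ∧ mk e he = α := by
  obtain ⟨n, _, e, he, heI, rfl⟩ := hα
  let σ := (Fintype.equivFin n).symm
  refine ⟨Fintype.card n, e.submatrix σ σ, ?_, fun i j => heI _ _,
    (mk_eq_mk_of_submatrix σ rfl).symm⟩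
  rw [IsIdempotentElem, Matrix.submatrix_mul_equiv, he.eq]

theorem eq_of_add_self_eq {I : TwoSidedIdeal R} (hI : IsSeparativeIdeal I) {α β : IdemClass R}
    (hα : α ∈ ofIdeal I) (hβ : β ∈ ofIdeal I) (h₁ : α + α = α + β) (h₂ : α + β = β + β) :
    α = β := by
  obtain ⟨n, e, he, heI, rfl⟩ := exists_fin_of_mem_ofIdeal hα
  obtain ⟨m, f, hf, hfI, rfl⟩ := exists_fin_of_mem_ofIdeal hβ
  rw [mk_add_mk, mk_add_mk, mk_eq_mk] at h₁ h₂
  exact mk_eq_mk.2 (hI n m e f he hf heI hfI h₁ h₂)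

end IdemClass

/-! ### Separative cancellation -/

section Cancellation

variable {M : Type*} [AddCommMonoid M] {S : AddSubmonoid M}

theorem add_self_eq_of_succ_nsmul_eq
    (hS : ∀ a ∈ S, ∀ b ∈ S, a + a = a + b → a + b = b + b → a = b) {a b : M}
    (ha : a ∈ S) (hb : b ∈ S) (n : ℕ) (h : n • a + a = n • a + b) : a + a = a + b := by
  induction n with
  | zero => simp only [zero_nsmul, zero_add] at h; rw [← h]
  | succ n ih =>
    rcases n with _ | n
    · simpa using h
    refine ih (hS _ (S.add_mem (S.nsmul_mem ha _) ha) _ (S.add_mem (S.nsmul_mem ha _) hb) ?_ ?_)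
    · calc (n + 1) • a + a + ((n + 1) • a + a) = (n + 1) • a + ((n + 1 + 1) • a + a) := by
            simp only [succ_nsmul]; abel
        _ = (n + 1) • a + a + ((n + 1) • a + b) := by
            rw [h]; simp only [succ_nsmul]; abel
    · calc (n + 1) • a + a + ((n + 1) • a + b) = (n • a + b) + ((n + 1 + 1) • a + a) := by
            simp only [succ_nsmul]; abel
        _ = (n + 1) • a + b + ((n + 1) • a + b) := by
            rw [h]; simp only [succ_nsmul]; abel

theorem eq_of_add_eq_add_of_le_nsmul
    (hS : ∀ a ∈ S, ∀ b ∈ S, a + a = a + b → a + b = b + b → a = b) {a b c v w : M}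
    (ha : a ∈ S) (hb : b ∈ S) (m n : ℕ) (h : a + c = b + c)
    (hca : c + v = m • a) (hcb : c + w = n • b) : a = b := by
  have h₁ : a + a = a + b := add_self_eq_of_succ_nsmul_eq hS ha hb m <| by
    rw [← hca, add_right_comm, add_comm c a, h, add_comm b c, add_right_comm]
  have h₂ : b + b = b + a := add_self_eq_of_succ_nsmul_eq hS hb ha n <| by
    rw [← hcb, add_right_comm, add_comm c b, ← h, add_comm a c, add_right_comm]
  exact hS a ha b hb h₁ (by rw [h₂, add_comm])

end Cancellation

/-! ### Classes of idempotent elements -/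

namespace IdemClass

variable {R : Type*} [Ring R]

/-- The class of an idempotent element, viewed as a `1 × 1` matrix. -/
def single (e : R) (he : IsIdempotentElem e) : IdemClass R :=
  mk (Matrix.of fun _ _ : Unit => e) <| show IsIdempotentElem _ from by
    ext; simpa [IsIdempotentElem, Matrix.mul_apply] using he.eq

theorem single_eq_single {e f : R} {he : IsIdempotentElem e} {hf : IsIdempotentElem f} :
    single e he = single f hf ↔ ∃ x y : R, x * y = e ∧ y * x = f := by
  rw [single, single, mk_eq_mk]
  constructor
  · rintro ⟨x, y, h₁, h₂⟩
    refine ⟨x () (), y () (), ?_, ?_⟩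
    · simpa [Matrix.mul_apply] using congr_fun (congr_fun h₁ ()) ()
    · simpa [Matrix.mul_apply] using congr_fun (congr_fun h₂ ()) ()
  · rintro ⟨x, y, rfl, rfl⟩
    exact ⟨.of fun _ _ => x, .of fun _ _ => y, by ext; simp [Matrix.mul_apply],
      by ext; simp [Matrix.mul_apply]⟩

theorem single_mem_ofIdeal {I : TwoSidedIdeal R} {e : R} (he : IsIdempotentElem e) (heI : e ∈ I) :
    single e he ∈ ofIdeal I :=
  ⟨Unit, inferInstance, _, _, fun _ _ => heI, rfl⟩

theorem single_eq_add {e f g : R} (he : IsIdempotentElem e) (hf : IsIdempotentElem f)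
    (hg : IsIdempotentElem g) (hef : e * f = 0) (hfe : f * e = 0) (h : e + f = g) :
    single g hg = single e he + single f hf := by
  subst h
  rw [single, single, single, mk_add_mk, mk_eq_mk]
  refine ⟨.of fun _ => Sum.elim (fun _ => e) (fun _ => f),
    .of fun i _ => Sum.elim (fun _ => e) (fun _ => f) i, ?_, ?_⟩
  · ext
    simp [Matrix.mul_apply, he.eq, hf.eq]
  · ext (i | i) (j | j) <;> simp [Matrix.mul_apply, he.eq, hf.eq, hef, hfe]

/-- A subidempotent splits off the class of an idempotent. -/
theorem single_eq_add_sub {e f : R} (he : IsIdempotentElem e) (hf : IsIdempotentElem f)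
    (hef : e * f = f) (hfe : f * e = f) (hd : IsIdempotentElem (e - f)) :
    single e he = single f hf + single (e - f) hd :=
  single_eq_add hf hd he (by rw [mul_sub, hfe, hf.eq, sub_self])
    (by rw [sub_mul, hef, hf.eq, sub_self]) (by abel)

end IdemClass

theorem IsIdempotentElem.sub_of_mul_eq {R : Type*} [Ring R] {e f : R} (he : IsIdempotentElem e)
    (hf : IsIdempotentElem f) (hef : e * f = f) (hfe : f * e = f) : IsIdempotentElem (e - f) := by
  simp [IsIdempotentElem, mul_sub, sub_mul, he.eq, hf.eq, hef, hfe]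

theorem IsIdempotentElem.add_of_mul_eq_zero {R : Type*} [Ring R] {e f : R}
    (he : IsIdempotentElem e) (hf : IsIdempotentElem f) (hef : e * f = 0) (hfe : f * e = 0) :
    IsIdempotentElem (e + f) := by
  simp [IsIdempotentElem, mul_add, add_mul, he.eq, hf.eq, hef, hfe]

/-! ### Exchange in corners -/

section Exchange

open IdemClass

variable {R : Type*} [Ring R] {I : TwoSidedIdeal R}

/-- The corner of an exchange ideal at an idempotent `b` is an exchange ring. -/
theorem IsExchangeIdeal.exists_corner (hI : IsExchangeIdeal I) {b x : R} (hbI : b ∈ I)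
    (hb : IsIdempotentElem b) (hbx : b * x = x) :
    ∃ g r s : R, IsIdempotentElem g ∧ b * g = g ∧ g * b = g ∧ g = x * r ∧ b - g = (b - x) * s := by
  obtain ⟨e, -, r, -, s, -, he, her, hes⟩ := hI x (hbx ▸ I.mul_mem_right _ _ hbI)
  have hbe : b * e = e := by rw [her, ← mul_assoc, hbx]
  refine ⟨e * b, r * b, (1 - s) * b, ?_, ?_, ?_, ?_, ?_⟩
  · rw [IsIdempotentElem, mul_assoc, ← mul_assoc b, hbe, ← mul_assoc, he.eq]
  · rw [← mul_assoc, hbe]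
  · rw [mul_assoc, hb.eq]
  · rw [← mul_assoc, ← her]
  · calc b - e * b = b * b - b * e * b := by rw [hb.eq, hbe]
      _ = b * (1 - e) * b := by noncomm_ring
      _ = (b - b * x) * ((1 - s) * b) := by rw [hes]; noncomm_ring
      _ = (b - x) * ((1 - s) * b) := by rw [hbx]

theorem mem_of_equiv {g j x y : R} (hj : IsIdempotentElem j) (hg : g ∈ I) (hxy : x * y = g)
    (hyx : y * x = j) : j ∈ I := by
  have : j = y * g * x := by rw [← hj.eq, ← hyx, ← hxy]; simp only [mul_assoc]
  rw [this]
  exact I.mul_mem_right _ _ (I.mul_mem_left _ _ hg)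

/-- An idempotent factoring through `f` is equivalent to a subidempotent of `f`. -/
theorem exists_subidempotent {g f u v : R} (hgI : g ∈ I) (hg : IsIdempotentElem g)
    (hf : IsIdempotentElem f) (h : g = u * f * v) :
    ∃ (j : R) (hj : IsIdempotentElem j), j ∈ I ∧ f * j = j ∧ j * f = j ∧
      single g hg = single j hj := by
  have hxy : g * u * f * (f * v * g) = g :=
    calc g * u * f * (f * v * g) = g * (u * (f * f) * v) * g := by simp only [mul_assoc]
      _ = g := by rw [hf.eq, ← h, hg.eq, hg.eq]
  have hyx : IsIdempotentElem (f * v * g * (g * u * f)) :=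
    calc f * v * g * (g * u * f) * (f * v * g * (g * u * f))
        = f * v * g * (g * u * f * (f * v * g)) * (g * u * f) := by simp only [mul_assoc]
      _ = f * v * (g * g) * (g * u * f) := by rw [hxy]; simp only [mul_assoc]
      _ = f * v * g * (g * u * f) := by rw [hg.eq]
  refine ⟨_, hyx, mem_of_equiv hyx hgI hxy rfl, ?_, ?_, single_eq_single.2 ⟨_, _, hxy, rfl⟩⟩
  · simp only [← mul_assoc, hf.eq]
  · simp only [mul_assoc, hf.eq]

/-- Any two subidempotents `k`, `g` of `f` lying in `I` are dominated by a subidempotent of `f`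
in `I`, which can be chosen to contain `k`. -/
theorem IsExchangeIdeal.exists_sup (hI : IsExchangeIdeal I) {f k g : R}
    (hf : IsIdempotentElem f) (hkI : k ∈ I) (hk : IsIdempotentElem k)
    (hfk : f * k = k) (hkf : k * f = k) (hgI : g ∈ I) (hg : IsIdempotentElem g)
    (hfg : f * g = g) :
    ∃ (k' : R) (hk' : IsIdempotentElem k') (v : IdemClass R), k' ∈ I ∧ f * k' = k' ∧ k' * f = k' ∧
      k' * k = k ∧ k * k' = k ∧ single g hg + v = single k' hk' := by
  obtain ⟨g₁, r, s, hg₁, hgg₁, hg₁g, hr, hs⟩ := hI.exists_corner (x := g * k * g) hgI hg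
    (by rw [← mul_assoc, ← mul_assoc, hg.eq])
  have hg₂ := hg.sub_of_mul_eq hg₁ hgg₁ hg₁g
  have hfk' := hf.sub_of_mul_eq hk hfk hkf
  have hg₁I : g₁ ∈ I := hgg₁ ▸ I.mul_mem_right _ _ hgI
  obtain ⟨i, hi, -, hki, hik, hgi⟩ := exists_subidempotent (f := k) (u := g) (v := g * r)
    hg₁I hg₁ hk (by rw [hr]; simp only [mul_assoc])
  obtain ⟨j, hj, hjI, hfj, hjf, hgj⟩ := exists_subidempotent (f := f - k) (u := g) (v := g * s)
    (I.sub_mem hgI hg₁I) hg₂ hfk' (by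
      calc g - g₁ = (g * (f * g) - g * k * g) * s := by rw [hs, hfg, hg.eq]
        _ = g * (f - k) * (g * s) := by noncomm_ring)
  have hkj : k * j = 0 := by
    rw [← hfj, ← mul_assoc, mul_sub, hkf, hk.eq, sub_self, zero_mul]
  have hjk : j * k = 0 := by
    rw [← hjf, mul_assoc, sub_mul, hfk, hk.eq, sub_self, mul_zero]
  have hfj' : f * j = j := by
    rw [sub_mul, hkj, sub_zero] at hfj; exact hfj
  have hjf' : j * f = j := by
    rw [mul_sub, hjk, sub_zero] at hjf; exact hjf
  refine ⟨k + j, hk.add_of_mul_eq_zero hj hkj hjk, single (k - i) (hk.sub_of_mul_eq hi hki hik),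
    I.add_mem hkI hjI, by rw [mul_add, hfk, hfj'], by rw [add_mul, hkf, hjf'],
    by rw [add_mul, hk.eq, hjk, add_zero], by rw [mul_add, hk.eq, hkj, add_zero], ?_⟩
  rw [single_eq_add hk hj _ hkj hjk rfl, single_eq_add_sub hg hg₁ hgg₁ hg₁g hg₂, hgi, hgj,
    single_eq_add_sub hk hi hki hik (hk.sub_of_mul_eq hi hki hik)]
  abel

/-- An idempotent of `I` in the two-sided ideal generated by `f` is dominated by a multiple of a
subidempotent of `f` in `I`, which can be chosen to contain a given one. -/
theorem IsExchangeIdeal.exists_le_nsmul (hI : IsExchangeIdeal I) {f : R}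
    (hf : IsIdempotentElem f) (n : ℕ) :
    ∀ {c k : R} (x y : Fin n → R) (_ : c ∈ I) (hc : IsIdempotentElem c) (_ : k ∈ I)
      (_ : IsIdempotentElem k) (_ : f * k = k) (_ : k * f = k) (_ : ∑ i, x i * f * y i = c),
      ∃ (k' : R) (hk' : IsIdempotentElem k') (m : ℕ) (v : IdemClass R), k' ∈ I ∧ f * k' = k' ∧
        k' * f = k' ∧ k' * k = k ∧ k * k' = k ∧ single c hc + v = m • single k' hk' := by
  induction n with
  | zero =>
    intro c k x y _ hc hkI hk hfk hkf h
    refine ⟨k, hk, 0, 0, hkI, hfk, hkf, hk, hk, ?_⟩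
    obtain rfl : 0 = c := by simpa using h
    have h0 : single (0 : R) hc = 0 :=
      mk_eq_mk.2 ⟨0, 0, by ext; simp, by ext i; exact i.elim⟩
    rw [h0, zero_nsmul, add_zero]
  | succ n ih =>
    intro c k x y hcI hc hkI hk hfk hkf h
    rw [Fin.sum_univ_succ] at h
    obtain ⟨g, r, s, hg, hcg, hgc, hr, hs⟩ := hI.exists_corner (x := c * (x 0 * f * y 0) * c)
      hcI hc (by rw [← mul_assoc, ← mul_assoc, hc.eq])
    have hgI : g ∈ I := hcg ▸ I.mul_mem_right _ _ hcI
    have hcg' := hc.sub_of_mul_eq hg hcg hgc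
    obtain ⟨j, hj, hjI, hfj, hjf, hgj⟩ := exists_subidempotent (f := f) (u := c * x 0)
      (v := y 0 * c * r) hgI hg hf (by rw [hr]; simp only [mul_assoc])
    obtain ⟨k₁, hk₁, v₁, hk₁I, hfk₁, hk₁f, hk₁k, hkk₁, hv₁⟩ :=
      hI.exists_sup hf hkI hk hfk hkf hjI hj hfj
    obtain ⟨k₂, hk₂, m, v₂, hk₂I, hfk₂, hk₂f, hk₂k₁, hk₁k₂, hv₂⟩ :=
      ih (fun i => c * x i.succ) (fun i => y i.succ * c * s) (I.sub_mem hcI hgI) hcg' hk₁I hk₁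
        hfk₁ hk₁f (by
          have hc' : c - c * (x 0 * f * y 0) * c =
              c * (∑ i : Fin n, x i.succ * f * y i.succ) * c := by
            rw [eq_sub_of_add_eq' h, mul_sub, sub_mul, hc.eq, hc.eq]
          rw [hs, hc', Finset.mul_sum, Finset.sum_mul, Finset.sum_mul]
          simp only [mul_assoc])
    refine ⟨k₂, hk₂, m + 1, v₁ + single (k₂ - k₁) (hk₂.sub_of_mul_eq hk₁ hk₂k₁ hk₁k₂) + v₂, hk₂I,
      hfk₂, hk₂f, by rw [← hk₁k, ← mul_assoc, hk₂k₁], by rw [← hkk₁, mul_assoc, hk₁k₂], ?_⟩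
    rw [succ_nsmul, ← hv₂,
      single_eq_add_sub hk₂ hk₁ hk₂k₁ hk₁k₂ (hk₂.sub_of_mul_eq hk₁ hk₂k₁ hk₁k₂), ← hv₁,
      single_eq_add_sub hc hg hcg hgc hcg', hgj]
    abel

/-- The exchange property of the summand `bR` in the decomposition `R = pR ⊕ (1 - p)R`. -/
theorem IsExchangeIdeal.exists_decomposition (hI : IsExchangeIdeal I) {b p : R} (hbI : b ∈ I)
    (hb : IsIdempotentElem b) (hp : IsIdempotentElem p) :
    ∃ h₁ h₂ : R, IsIdempotentElem h₁ ∧ IsIdempotentElem h₂ ∧ h₁ ∈ I ∧ h₂ ∈ I ∧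
      p * h₁ = h₁ ∧ h₁ * p = h₁ ∧ (1 - p) * h₂ = h₂ ∧ h₂ * (1 - p) = h₂ ∧
      (∃ x y, x * y = h₁ + h₂ ∧ y * x = b) ∧ ∃ x y, x * y = 1 - b ∧ y * x = 1 - (h₁ + h₂) := by
  obtain ⟨g, r, s, hg, hbg, hgb, hr, hs⟩ := hI.exists_corner (x := b * p * b) hbI hb
    (by rw [← mul_assoc, ← mul_assoc, hb.eq])
  set a := 1 - p with ha_def
  have ha : IsIdempotentElem a := hp.one_sub
  have hpa : p * a = 0 := hp.mul_one_sub_self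
  have hap : a * p = 0 := hp.one_sub_mul_self
  obtain ⟨g', hg'_def⟩ : ∃ g', g' = b - g := ⟨_, rfl⟩
  have hg' : IsIdempotentElem g' := hg'_def ▸ hb.sub_of_mul_eq hg hbg hgb
  have hg'b : g' * b = g' := by rw [hg'_def, sub_mul, hb.eq, hgb]
  have hgg' : g * g' = 0 := by rw [hg'_def, mul_sub, hgb, hg.eq, sub_self]
  have hg'g : g' * g = 0 := by rw [hg'_def, sub_mul, hbg, hg.eq, sub_self]
  have hadd : g + g' = b := by rw [hg'_def]; abel
  have hbab : b - b * p * b = b * a * b := by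
    rw [ha_def, mul_sub, sub_mul, mul_one, hb.eq]
  rw [← hg'_def, hbab] at hs
  obtain ⟨u, hu, hug⟩ : ∃ u, b * p * u = g ∧ u * g = u := by
    refine ⟨b * r * g, ?_, by rw [mul_assoc, hg.eq]⟩
    rw [← mul_assoc, ← mul_assoc, ← hr, hg.eq]
  obtain ⟨v, hv, hvg⟩ : ∃ v, b * a * v = g' ∧ v * g' = v := by
    refine ⟨b * s * g', ?_, by rw [mul_assoc, hg'.eq]⟩
    rw [← mul_assoc, ← mul_assoc, ← hs, hg'.eq]
  have hgpu : g * p * u = g := by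
    rw [← hgb, mul_assoc g, mul_assoc g, hu, hg.eq, hgb]
  have hgav : g' * a * v = g' := by
    rw [← hg'b, mul_assoc g', mul_assoc g', hv, hg'.eq, hg'b]
  have hug' : u * g' = 0 := by rw [← hug, mul_assoc, hgg', mul_zero]
  have hvg' : v * g = 0 := by rw [← hvg, mul_assoc, hg'g, mul_zero]
  have hupu : u * p * u = u := by
    calc u * p * u = u * (g * p * u) := by rw [← mul_assoc, ← mul_assoc, hug]
      _ = u := by rw [hgpu, hug]
  have hvav : v * a * v = v := by
    calc v * a * v = v * (g' * a * v) := by rw [← mul_assoc, ← mul_assoc, hvg]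
      _ = v := by rw [hgav, hvg]
  have hgI : g ∈ I := hbg ▸ I.mul_mem_right _ _ hbI
  have hg'I : g' ∈ I := hg'_def ▸ I.sub_mem hbI hgI
  obtain ⟨w, hw⟩ : ∃ w, w = p * u + a * v := ⟨_, rfl⟩
  obtain ⟨t, ht⟩ : ∃ t, t = g * p + g' * a := ⟨_, rfl⟩
  have hwt : w * t = p * u * p + a * v * a := by
    rw [hw, ht]
    calc _ = p * (u * g) * p + p * (u * g') * a + a * (v * g) * p + a * (v * g') * a := by
          noncomm_ring
      _ = _ := by rw [hug, hug', hvg', hvg]; simp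
  have htw : t * w = b := by
    rw [hw, ht]
    calc _ = g * (p * p) * u + g * (p * a) * v + g' * (a * p) * u + g' * (a * a) * v := by
          noncomm_ring
      _ = _ := by rw [hp.eq, ha.eq, hpa, hap, hgpu, hgav]; simp [hadd]
  have hbw : b * w = b := by
    rw [hw, mul_add, ← mul_assoc, ← mul_assoc, hu, hv, hadd]
  have hwb : w * b = w := by
    have hub : u * b = u := by rw [← hug, mul_assoc, hgb]
    have hvb : v * b = v := by rw [← hvg, mul_assoc, hg'b]
    rw [hw, add_mul, mul_assoc, mul_assoc, hub, hvb]
  refine ⟨p * u * p, a * v * a, ?_, ?_, ?_, ?_, ?_, ?_, ?_, ?_, ⟨w, t, hwt, htw⟩, ?_⟩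
  · calc p * u * p * (p * u * p) = p * (u * (p * p) * u) * p := by simp only [mul_assoc]
      _ = p * u * p := by rw [hp.eq, hupu]
  · calc a * v * a * (a * v * a) = a * (v * (a * a) * v) * a := by simp only [mul_assoc]
      _ = a * v * a := by rw [ha.eq, hvav]
  · rw [← hug]
    exact I.mul_mem_right _ _ (I.mul_mem_left _ _ (I.mul_mem_left _ _ hgI))
  · rw [← hvg]
    exact I.mul_mem_right _ _ (I.mul_mem_left _ _ (I.mul_mem_left _ _ hg'I))
  · rw [← mul_assoc, ← mul_assoc, hp.eq]
  · rw [mul_assoc, hp.eq]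
  · rw [← mul_assoc, ← mul_assoc, ha.eq]
  · rw [mul_assoc, ha.eq]
  · rw [← hwt]
    have h₁ : (1 - w) * (1 - w * t) = 1 - w := by
      calc _ = 1 - w - w * t + w * (w * t) := by noncomm_ring
        _ = 1 - w - w * t + w * b * w * t := by rw [hwb]; simp only [mul_assoc]
        _ = 1 - w := by rw [mul_assoc w b, hbw, hwb]; abel
    have h₂ : (1 - w * t) * (1 - w) = 1 - w * t := by
      calc _ = 1 - w * t - w + w * (t * w) := by noncomm_ring
        _ = 1 - w * t := by rw [htw, hwb]; abel
    refine ⟨1 - w, (1 - w * t) * (1 - b), ?_, ?_⟩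
    · rw [← mul_assoc, h₁]
      calc _ = 1 - w - b + w * b := by noncomm_ring
        _ = 1 - b := by rw [hwb]; abel
    · rw [mul_assoc]
      calc _ = (1 - w * t) * (1 - b - w + b * w) := by noncomm_ring
        _ = (1 - w * t) * (1 - w) := by rw [hbw]; congr 1; abel
        _ = 1 - w * t := h₂

end Exchange

/-- Full idempotents with equivalent complements in a separative exchange ideal are equivalent. -/
theorem exists_equiv_of_one_sub_equiv {R : Type*} [Ring R] {I : TwoSidedIdeal R}
    (hIex : IsExchangeIdeal I) (hIsep : IsSeparativeIdeal I) {p q : R}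
    (hp : IsIdempotentElem p) (hq : IsIdempotentElem q)
    (hp' : 1 - p ∈ I) (hq' : 1 - q ∈ I) (hpq : ∃ x y : R, x * y = 1 - p ∧ y * x = 1 - q)
    (hpfull : ∃ (n : ℕ) (x y : Fin n → R), ∑ i, x i * p * y i = 1)
    (hqfull : ∃ (n : ℕ) (x y : Fin n → R), ∑ i, x i * q * y i = 1) :
    ∃ x y : R, x * y = p ∧ y * x = q := by
  open IdemClass in
  obtain ⟨h₁, h₂, hh₁, hh₂, hh₁I, hh₂I, hph₁, hh₁p, hah₂, hh₂a, ⟨z, t, hzt, htz⟩, x, y, hxy, hyx⟩ :=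
    hIex.exists_decomposition hq' hq.one_sub hp
  rw [sub_sub_cancel] at hxy
  have hh₁₂ : h₁ * h₂ = 0 := by
    rw [← hh₁p, ← hah₂, mul_assoc, ← mul_assoc p, hp.mul_one_sub_self, zero_mul, mul_zero]
  have hh₂₁ : h₂ * h₁ = 0 := by
    rw [← hh₂a, ← hph₁, mul_assoc, ← mul_assoc (1 - p), hp.one_sub_mul_self, zero_mul, mul_zero]
  have hh := hh₁.add_of_mul_eq_zero hh₂ hh₁₂ hh₂₁
  have hs := hp.sub_of_mul_eq hh₁ hph₁ hh₁p
  have hy := hp.one_sub.sub_of_mul_eq hh₂ hah₂ hh₂a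
  have hyI : 1 - p - h₂ ∈ I := I.sub_mem hp' hh₂I
  obtain ⟨s, hs_def⟩ : ∃ s, s = p - h₁ := ⟨_, rfl⟩
  obtain ⟨e, he_def⟩ : ∃ e, e = 1 - p - h₂ := ⟨_, rfl⟩
  rw [← hs_def] at hs
  rw [← he_def] at hy hyI
  have hpe : p * e = 0 := by
    rw [he_def, ← hah₂, mul_sub, ← mul_assoc, hp.mul_one_sub_self, zero_mul, sub_zero]
  have hep : e * p = 0 := by
    rw [he_def, ← hh₂a, sub_mul, mul_assoc, hp.one_sub_mul_self, mul_zero, sub_zero]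
  have hps : p * s = s := by rw [hs_def, mul_sub, hp.eq, hph₁]
  have hsp : s * p = s := by rw [hs_def, sub_mul, hp.eq, hh₁p]
  have hse : s * e = 0 := by rw [← hsp, mul_assoc, hpe, mul_zero]
  have hes : e * s = 0 := by rw [← hps, ← mul_assoc, hep, zero_mul]
  have hse_idem := hs.add_of_mul_eq_zero hy hse hes
  have hsum : 1 - (h₁ + h₂) = s + e := by rw [hs_def, he_def]; abel
  rw [hsum] at hyx
  obtain ⟨n, xs, ys, hxs⟩ := hpfull
  obtain ⟨k, hk, m₁, v₁, hkI, hpk, hkp, hkh₁, hh₁k, hv₁⟩ :=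
    hIex.exists_le_nsmul hp n xs (fun i => ys i * h₂) hh₂I hh₂ hh₁I hh₁ hph₁ hh₁p (by
      simp only [← mul_assoc]
      rw [← Finset.sum_mul, hxs, one_mul])
  obtain ⟨s₀, hs₀_def⟩ : ∃ s₀, s₀ = k - h₁ := ⟨_, rfl⟩
  have hs₀ : IsIdempotentElem s₀ := hs₀_def ▸ hk.sub_of_mul_eq hh₁ hkh₁ hh₁k
  have hps₀ : p * s₀ = s₀ := by rw [hs₀_def, mul_sub, hpk, hph₁]
  have hs₀p : s₀ * p = s₀ := by rw [hs₀_def, sub_mul, hkp, hh₁p]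
  have hh₁s₀ : h₁ * s₀ = 0 := by rw [hs₀_def, mul_sub, hh₁k, hh₁.eq, sub_self]
  have hs₀h₁ : s₀ * h₁ = 0 := by rw [hs₀_def, sub_mul, hkh₁, hh₁.eq, sub_self]
  have hss₀ : s * s₀ = s₀ := by rw [hs_def, sub_mul, hps₀, hh₁s₀, sub_zero]
  have hs₀s : s₀ * s = s₀ := by rw [hs_def, mul_sub, hs₀p, hs₀h₁, sub_zero]
  have hs₀e : s₀ * e = 0 := by rw [← hs₀p, mul_assoc, hpe, mul_zero]
  have hes₀ : e * s₀ = 0 := by rw [← hps₀, ← mul_assoc, hep, zero_mul]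
  have hs₀I : s₀ ∈ I := hs₀_def ▸ I.sub_mem hkI hh₁I
  obtain ⟨n', xs', ys', hxs'⟩ := hqfull
  obtain ⟨l, hl, m₂, v₂, hlI, hfl, hlf, hlk, hkl, hv₂⟩ :=
    hIex.exists_le_nsmul hse_idem n' (fun i => xs' i * x) (fun i => y * ys' i * h₂) hh₂I hh₂
      (I.add_mem hs₀I hyI) (hs₀.add_of_mul_eq_zero hy hs₀e hes₀)
      (by rw [add_mul, mul_add, mul_add, hss₀, hse, hes₀, hy.eq]; abel)
      (by rw [add_mul, mul_add, mul_add, hs₀s, hs₀e, hes, hy.eq]; abel)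
      (by
        have (i : Fin n') : xs' i * x * (s + e) * (y * ys' i * h₂) = xs' i * q * ys' i * h₂ := by
          calc _ = xs' i * ((x * y) * (x * y)) * ys' i * h₂ := by
                rw [← hyx]; simp only [mul_assoc]
            _ = _ := by rw [hxy, hq.eq]
        simp only [this]
        rw [← Finset.sum_mul, hxs', one_mul])
  have hle : l * e = e := by
    calc l * e = l * ((s₀ + e) * e) := by rw [add_mul, hs₀e, hy.eq, zero_add]
      _ = e := by rw [← mul_assoc, hlk, add_mul, hs₀e, hy.eq, zero_add]
  have hel : e * l = e := by
    calc e * l = e * (s₀ + e) * l := by rw [mul_add, hes₀, hy.eq, zero_add]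
      _ = e := by rw [mul_assoc, hkl, mul_add, hes₀, hy.eq, zero_add]
  have hls₀ : l * s₀ = s₀ := by
    calc l * s₀ = l * ((s₀ + e) * s₀) := by rw [add_mul, hes₀, hs₀.eq, add_zero]
      _ = s₀ := by rw [← mul_assoc, hlk, add_mul, hes₀, hs₀.eq, add_zero]
  have hs₀l : s₀ * l = s₀ := by
    calc s₀ * l = s₀ * (s₀ + e) * l := by rw [mul_add, hs₀e, hs₀.eq, add_zero]
      _ = s₀ := by rw [mul_assoc, hkl, mul_add, hs₀e, hs₀.eq, add_zero]
  obtain ⟨t₀, ht₀_def⟩ : ∃ t₀, t₀ = l - e := ⟨_, rfl⟩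
  have ht₀ : IsIdempotentElem t₀ := ht₀_def ▸ hl.sub_of_mul_eq hy hle hel
  have ht₀I : t₀ ∈ I := ht₀_def ▸ I.sub_mem hlI hyI
  have ht₀e : t₀ * e = 0 := by rw [ht₀_def, sub_mul, hle, hy.eq, sub_self]
  have het₀ : e * t₀ = 0 := by rw [ht₀_def, mul_sub, hel, hy.eq, sub_self]
  have hst₀ : s * t₀ = t₀ := by
    calc s * t₀ = (s + e) * l - e * l - s * e := by rw [ht₀_def]; noncomm_ring
      _ = t₀ := by rw [hfl, hel, hse, sub_zero, ht₀_def]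
  have ht₀s : t₀ * s = t₀ := by
    calc t₀ * s = l * (s + e) - l * e - e * s := by rw [ht₀_def]; noncomm_ring
      _ = t₀ := by rw [hlf, hle, hes, sub_zero, ht₀_def]
  have ht₀s₀ : t₀ * s₀ = s₀ := by rw [ht₀_def, sub_mul, hls₀, hes₀, sub_zero]
  have hs₀t₀ : s₀ * t₀ = s₀ := by rw [ht₀_def, mul_sub, hs₀l, hs₀e, sub_zero]
  have hsh₁ : s * h₁ = 0 := by rw [hs_def, sub_mul, hph₁, hh₁.eq, sub_self]
  have hh₁s : h₁ * s = 0 := by rw [hs_def, mul_sub, hh₁p, hh₁.eq, sub_self]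
  have hts := hs.sub_of_mul_eq ht₀ hst₀ ht₀s
  have hst := ht₀.sub_of_mul_eq hs₀ ht₀s₀ hs₀t₀
  have hk_eq : single k hk = single s₀ hs₀ + single h₁ hh₁ :=
    single_eq_add hs₀ hh₁ hk hs₀h₁ hh₁s₀ (by rw [hs₀_def]; abel)
  have hl_eq : single l hl = single t₀ ht₀ + single e hy :=
    single_eq_add ht₀ hy hl ht₀e het₀ (by rw [ht₀_def]; abel)
  have ht₀_eq := single_eq_add_sub ht₀ hs₀ ht₀s₀ hs₀t₀ hst
  have hs_eq := single_eq_add_sub hs ht₀ hst₀ ht₀s hts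
  have hp_eq : single p hp = single s hs + single h₁ hh₁ :=
    single_eq_add hs hh₁ hp hsh₁ hh₁s (by rw [hs_def]; abel)
  have hq_eq : single q hq = single s hs + single e hy :=
    (single_eq_single.2 ⟨x, y, hxy, hyx⟩).trans
      (single_eq_add hs hy hse_idem hse hes rfl)
  have ha_eq : single (1 - p) hp.one_sub = single h₁ hh₁ + single h₂ hh₂ :=
    (single_eq_single.2 hpq).trans
      ((single_eq_single (he := hh) (hf := hq.one_sub)).2 ⟨z, t, hzt, htz⟩ |>.symm.trans
        (single_eq_add hh₁ hh₂ hh hh₁₂ hh₂₁ rfl))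
  have ha_eq' : single (1 - p) hp.one_sub = single e hy + single h₂ hh₂ := by
    rw [single_eq_add_sub hp.one_sub hh₂ hah₂ hh₂a (he_def ▸ hy), add_comm]
    simp only [he_def]
  have key : single t₀ ht₀ + single h₁ hh₁ = single t₀ ht₀ + single e hy := by
    refine eq_of_add_eq_add_of_le_nsmul (S := ofIdeal I) (c := single h₂ hh₂)
      (v := v₁ + m₁ • single (t₀ - s₀) hst) (w := v₂)
      (fun a ha b hb => eq_of_add_self_eq hIsep ha hb)
      (add_mem (single_mem_ofIdeal _ ht₀I) (single_mem_ofIdeal _ hh₁I))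
      (add_mem (single_mem_ofIdeal _ ht₀I) (single_mem_ofIdeal _ hyI)) m₁ m₂ ?_ ?_ ?_
    · rw [add_assoc, ← ha_eq, ha_eq', add_assoc]
    · rw [← add_assoc, hv₁, ← nsmul_add, hk_eq, ht₀_eq, add_right_comm]
    · rw [hv₂, hl_eq]
  refine (single_eq_single (he := hp) (hf := hq)).1 ?_
  rw [hp_eq, hq_eq, hs_eq, add_right_comm, key, add_right_comm]

/-- Let `I` be a separative exchange ideal of a unital ring `R`,
`d ∈ I`, and `p, q` idempotents with `1 - p, 1 - q ∈ I`, `dR = (1-p)R`, `Rd = R(1-q)`.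
If `RpR = RqR = R` then `p ∼ q`, and `d` is unit-regular. -/
theorem lifting_units_stmt2 {R : Type*} [Ring R] (I : TwoSidedIdeal R)
    (hIex : IsExchangeIdeal I) (hIsep : IsSeparativeIdeal I)
    (d p q : R) (hd : d ∈ I)
    (hp : IsIdempotentElem p) (hq : IsIdempotentElem q)
    (hp' : 1 - p ∈ I) (hq' : 1 - q ∈ I)
    (hdR : ∀ z : R, (∃ r, z = d * r) ↔ (∃ r, z = (1 - p) * r))
    (hRd : ∀ z : R, (∃ r, z = r * d) ↔ (∃ r, z = r * (1 - q)))
    (hpfull : ∃ (n : ℕ) (x y : Fin n → R), ∑ i, x i * p * y i = 1)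
    (hqfull : ∃ (n : ℕ) (x y : Fin n → R), ∑ i, x i * q * y i = 1) :
    (∃ x y : R, x * y = p ∧ y * x = q) ∧ (∃ u : Rˣ, d = d * (u : R) * d) := by
  obtain ⟨r, hr⟩ := (hdR (1 - p)).2 ⟨1, (mul_one _).symm⟩
  obtain ⟨r', hr'⟩ := (hdR d).1 ⟨1, (mul_one _).symm⟩
  obtain ⟨l, hl⟩ := (hRd (1 - q)).2 ⟨1, (one_mul _).symm⟩
  obtain ⟨l', hl'⟩ := (hRd d).1 ⟨1, (one_mul _).symm⟩
  have hpd : p * d = 0 := by rw [hr', ← mul_assoc, hp.mul_one_sub_self, zero_mul]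
  have hdq : d * q = 0 := by rw [hl', mul_assoc, hq.one_sub_mul_self, mul_zero]
  have had : (1 - p) * d = d := by rw [sub_mul, hpd, one_mul, sub_zero]
  have hdb : d * (1 - q) = d := by rw [mul_sub, hdq, mul_one, sub_zero]
  obtain ⟨z, hz⟩ : ∃ z, z = (1 - q) * r * (1 - p) := ⟨_, rfl⟩
  have hdz : d * z = 1 - p := by
    rw [hz, ← mul_assoc, ← mul_assoc, hdb, ← hr, hp.one_sub.eq]
  have hzd : z * d = 1 - q := by
    rw [hz, mul_assoc, had, hl, mul_assoc l, mul_assoc l, ← hr, had]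
  have hzp : z * p = 0 := by rw [hz, mul_assoc, hp.one_sub_mul_self, mul_zero]
  have hqz : q * z = 0 := by
    rw [hz, ← mul_assoc, ← mul_assoc, hq.mul_one_sub_self, zero_mul, zero_mul]
  obtain ⟨x, y, hxy, hyx⟩ := exists_equiv_of_one_sub_equiv hIex hIsep hp hq hp' hq'
    ⟨d, z, hdz, hzd⟩ hpfull hqfull
  refine ⟨⟨x, y, hxy, hyx⟩, ⟨z + q * y, d + x * q, ?_, ?_⟩, ?_⟩
  · have hzx : z * x * q = 0 := by
      rw [mul_assoc, ← hyx, ← mul_assoc x, hxy, ← mul_assoc, hzp, zero_mul]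
    have hyd : q * y * d = 0 := by
      rw [← hyx, mul_assoc y, hxy, mul_assoc, hpd, mul_zero]
    calc (z + q * y) * (d + x * q) = z * d + z * x * q + q * y * d + q * (y * x) * q := by
          noncomm_ring
      _ = 1 := by rw [hzd, hzx, hyd, hyx, hq.eq, hq.eq]; abel
  · calc (d + x * q) * (z + q * y) = d * z + d * q * y + x * (q * z) + x * (q * q) * y := by
          noncomm_ring
      _ = 1 - p + x * y * (x * y) := by
          rw [hdz, hdq, hqz, hq.eq, ← hyx]; simp only [zero_mul, mul_zero, add_zero, mul_assoc]
      _ = 1 := by rw [hxy, hp.eq]; abel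
  · calc d = (1 - p) * d + d * q * y * d := by rw [had, hdq, zero_mul, zero_mul, add_zero]
      _ = d * (z + q * y) * d := by rw [← hdz]; noncomm_ring
end

section
/- Let R be a unital ring, let I be an exchange ideal of R, and let e₁, e₂ ∈ R be idempotents with e₁ ∈ I. Then there exists an idempotent e ∈ e₁R + e₂R such that for i = 1, 2 there exist x_i, y_i ∈ R with x_i·y_i = e_i and y_i·x_i an idempotent satisfying (y_i·x_i)·e = e·(y_i·x_i) = y_i·x_i (that is, [e_i] ≤ [e] in V(R)); in particular ReR = Re₁R + Re₂R. -/
/-- If `x * y` is idempotent with `x` fixed by it on the left, and `e` fixes `x` on the right and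
`y` on the left, then `y * x` is an idempotent below `e`. -/
lemma idempotent_swap_of_fixed {R : Type*} [Ring R] {f e x y : R} (hxy : x * y = f)
    (hfx : f * x = x) (hxe : x * e = x) (hey : e * y = y) :
    IsIdempotentElem (y * x) ∧ (y * x) * e = y * x ∧ e * (y * x) = y * x := by
  refine ⟨?_, by rw [mul_assoc, hxe], by rw [← mul_assoc, hey]⟩
  change y * x * (y * x) = y * x
  rw [mul_assoc, ← mul_assoc x, hxy, hfx]

/-- A product `x * y` with `x` fixed by `e` on the right lies in the ideal generated by `e`. -/
lemma mul_mem_span_of_fixed {R : Type*} [Ring R] {e x : R} (y : R) (hxe : x * e = x) :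
    x * y ∈ TwoSidedIdeal.span {e} := by
  rw [← hxe]
  exact TwoSidedIdeal.mul_mem_right _ _ _
    (TwoSidedIdeal.mul_mem_left _ _ _ (TwoSidedIdeal.subset_span rfl))

/-- An idempotent `e₁` of an exchange ideal splits, relative to any element `z`, as an orthogonal
sum of idempotents of the form `e₁ * z * u` and `e₁ * (1 - z) * v`. -/
lemma IsExchangeIdeal.exists_orthogonal_decomposition {R : Type*} [Ring R] {I : TwoSidedIdeal R}
    (hI : IsExchangeIdeal I) {e₁ : R} (h₁ : IsIdempotentElem e₁) (he₁ : e₁ ∈ I) (z : R) :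
    ∃ p q u v : R, p * p = p ∧ q * q = q ∧ p * q = 0 ∧ q * p = 0 ∧ p + q = e₁ ∧
      e₁ * u = u ∧ p = e₁ * z * u ∧ q = e₁ * (1 - z) * v := by
  obtain ⟨f, -, r, -, s, -, hf, hfr, hfs⟩ :=
    hI (e₁ * z * e₁) (TwoSidedIdeal.mul_mem_left _ _ _ he₁)
  have h₁ : e₁ * e₁ = e₁ := h₁
  have hf : f * f = f := hf
  have hef : e₁ * f = f := by rw [hfr]; simp only [← mul_assoc, h₁]
  have hpp : f * e₁ * (f * e₁) = f * e₁ := by rw [mul_assoc, ← mul_assoc e₁, hef, ← mul_assoc, hf]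
  have hep : e₁ * (f * e₁) = f * e₁ := by rw [← mul_assoc, hef]
  have hpe : f * e₁ * e₁ = f * e₁ := by rw [mul_assoc, h₁]
  refine ⟨f * e₁, e₁ - f * e₁, e₁ * r * e₁, e₁ * (1 - s) * e₁, hpp, ?_, ?_, ?_, by abel, ?_, ?_, ?_⟩
  · rw [mul_sub, sub_mul, sub_mul, h₁, hep, hpe, hpp]; abel
  · rw [mul_sub, hpe, hpp, sub_self]
  · rw [sub_mul, hep, hpp, sub_self]
  · simp only [← mul_assoc, h₁]
  · rw [hfr]; simp only [mul_assoc]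
  · have hmul (t : R) : t * e₁ * e₁ = t * e₁ := by rw [mul_assoc, h₁]
    calc e₁ - f * e₁ = e₁ - e₁ * f * e₁ := by rw [hef]
      _ = e₁ * (1 - z) * (e₁ * (1 - s) * e₁) := by
        rw [hfs]
        simp only [h₁, hmul, mul_sub, sub_mul, mul_add, add_mul, ← mul_assoc, mul_one]
        abel

/-- Let `I` be an exchange ideal of a unital ring `R` and `e₁, e₂ ∈ R`
idempotents with `e₁ ∈ I`.  Then there is an idempotent `e ∈ e₁R + e₂R` such that
`[eᵢ] ≤ [e]` in `V(R)` for `i = 1, 2` (i.e. there are `xᵢ, yᵢ` with `xᵢyᵢ = eᵢ` and `yᵢxᵢ`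
an idempotent satisfying `(yᵢxᵢ)e = e(yᵢxᵢ) = yᵢxᵢ`); in particular `ReR = Re₁R + Re₂R`. -/
theorem lifting_units_stmt3 {R : Type*} [Ring R] (I : TwoSidedIdeal R)
    (hI : IsExchangeIdeal I)
    (e₁ e₂ : R) (h₁ : IsIdempotentElem e₁) (h₂ : IsIdempotentElem e₂) (he₁ : e₁ ∈ I) :
    ∃ e : R, IsIdempotentElem e ∧ (∃ r₁ r₂ : R, e = e₁ * r₁ + e₂ * r₂) ∧
      (∃ x y : R, x * y = e₁ ∧ IsIdempotentElem (y * x) ∧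
        (y * x) * e = y * x ∧ e * (y * x) = y * x) ∧
      (∃ x y : R, x * y = e₂ ∧ IsIdempotentElem (y * x) ∧
        (y * x) * e = y * x ∧ e * (y * x) = y * x) ∧
      TwoSidedIdeal.span {e} = TwoSidedIdeal.span {e₁} ⊔ TwoSidedIdeal.span {e₂} := by
  have h₂' : e₂ * e₂ = e₂ := h₂
  obtain ⟨p, q, u, v, hp, hq, hpq, hqp, hsum, heu, hpu, hqv⟩ :=
    hI.exists_orthogonal_decomposition h₁ he₁ (1 - e₂)
  have hpe : p * e₁ = p := by rw [← hsum, mul_add, hp, hpq, add_zero]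
  have hqe : q * e₁ = q := by rw [← hsum, mul_add, hq, hqp, zero_add]
  have hc : (1 - e₂) * (1 - e₂) = 1 - e₂ := h₂.one_sub
  rw [sub_sub_cancel] at hqv
  obtain ⟨a, ha⟩ : ∃ a, a = p * (1 - e₂) := ⟨_, rfl⟩
  obtain ⟨b, hb⟩ : ∃ b, b = (1 - e₂) * (u * p) := ⟨_, rfl⟩
  obtain ⟨c, hc'⟩ : ∃ c, c = q * e₂ := ⟨_, rfl⟩
  obtain ⟨d, hd⟩ : ∃ d, d = e₂ * (v * q) := ⟨_, rfl⟩
  have hab : a * b = p := by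
    calc a * b = p * ((1 - e₂) * (1 - e₂)) * u * p := by rw [ha, hb]; simp only [mul_assoc]
      _ = p * (e₁ * (1 - e₂) * u) * p := by rw [hc]; simp only [← mul_assoc, hpe]
      _ = p := by rw [← hpu, hp, hp]
  have hcd : c * d = q := by
    calc c * d = q * (e₂ * e₂) * v * q := by rw [hc', hd]; simp only [mul_assoc]
      _ = q * (e₁ * e₂ * v) * q := by rw [h₂']; simp only [← mul_assoc, hqe]
      _ = q := by rw [← hqv, hq, hq]
  have hpa : p * a = a := by rw [ha, ← mul_assoc, hp]
  have hbp : b * p = b := by rw [hb, mul_assoc, mul_assoc, hp]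
  have hqc : q * c = c := by rw [hc', ← mul_assoc, hq]
  have hae : a * e₂ = 0 := by rw [ha, mul_assoc, sub_mul, one_mul, h₂', sub_self, mul_zero]
  have heb : e₂ * b = 0 := by rw [hb, ← mul_assoc, mul_sub, mul_one, h₂', sub_self, zero_mul]
  have hce : c * e₂ = c := by rw [hc', mul_assoc, h₂']
  have hed : e₂ * d = d := by rw [hd, ← mul_assoc, h₂']
  have had : a * d = 0 := by rw [← hed, ← mul_assoc, hae, zero_mul]
  have hcb : c * b = 0 := by rw [← hce, mul_assoc, heb, mul_zero]
  have hpc : p * c = 0 := by rw [← hqc, ← mul_assoc, hpq, zero_mul]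
  have hqa : q * a = 0 := by rw [← hpa, ← mul_assoc, hqp, zero_mul]
  have hxy : (a + c) * (b + d) = e₁ := by
    rw [add_mul, mul_add, mul_add, hab, hcd, had, hcb, add_zero, zero_add, hsum]
  have hfx : e₁ * (a + c) = a + c := by
    rw [← hsum, add_mul, mul_add, mul_add, hpa, hqc, hpc, hqa, add_zero, zero_add]
  have hxe : (a + c) * (e₂ + b * a) = a + c := by
    rw [add_mul, mul_add, mul_add, ← mul_assoc, ← mul_assoc, hab, hcb, hae, hce, hpa, zero_mul,
      add_zero, zero_add]
  have hey : (e₂ + b * a) * (b + d) = b + d := by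
    rw [add_mul, mul_add, mul_add, mul_assoc, mul_assoc, hab, had, heb, hed, hbp, mul_zero,
      add_zero, zero_add, add_comm]
  have hee₂ : e₂ * (e₂ + b * a) = e₂ := by
    rw [mul_add, ← mul_assoc, heb, zero_mul, add_zero, h₂']
  have he₂e : (e₂ + b * a) * e₂ = e₂ := by
    rw [add_mul, mul_assoc, hae, mul_zero, add_zero, h₂']
  have hidem : IsIdempotentElem (e₂ + b * a) := by
    change (e₂ + b * a) * (e₂ + b * a) = e₂ + b * a
    rw [mul_add, he₂e, add_mul, ← mul_assoc e₂, heb, zero_mul, zero_add, mul_assoc,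
      ← mul_assoc a, hab, hpa]
  have hrep : e₂ + b * a = e₁ * (u * p * a) + e₂ * (1 - u * p * a) := by
    rw [hb, ← mul_assoc, ← mul_assoc e₁, ← mul_assoc e₁, heu]
    simp only [sub_mul, mul_sub, one_mul, mul_one, mul_assoc]
    abel
  refine ⟨e₂ + b * a, hidem, ⟨_, _, hrep⟩,
    ⟨_, _, hxy, idempotent_swap_of_fixed hxy hfx hxe hey⟩,
    ⟨_, _, h₂', idempotent_swap_of_fixed h₂' h₂' hee₂ he₂e⟩, le_antisymm ?_ (sup_le ?_ ?_)⟩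
  · rw [TwoSidedIdeal.span_le, Set.singleton_subset_iff, hrep]
    refine TwoSidedIdeal.add_mem _ (TwoSidedIdeal.mul_mem_right _ _ _ ?_)
      (TwoSidedIdeal.mul_mem_right _ _ _ ?_)
    · exact (le_sup_left : _ ≤ TwoSidedIdeal.span {e₁} ⊔ TwoSidedIdeal.span {e₂})
        (TwoSidedIdeal.subset_span rfl)
    · exact (le_sup_right : _ ≤ TwoSidedIdeal.span {e₁} ⊔ TwoSidedIdeal.span {e₂})
        (TwoSidedIdeal.subset_span rfl)
  · rw [TwoSidedIdeal.span_le, Set.singleton_subset_iff]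
    exact hxy ▸ mul_mem_span_of_fixed (b + d) hxe
  · rw [TwoSidedIdeal.span_le, Set.singleton_subset_iff]
    have h := mul_mem_span_of_fixed e₂ hee₂
    rwa [h₂'] at h
end

section
/- Let R be a unital ring, let I be an exchange ideal of R, and let c ∈ I and d ∈ R with cR + dR = R. Then there exists an idempotent e ∈ R with e ∈ cR and 1 − e ∈ dR such that: ec ∈ cRc, (1−e)d ∈ dRd, R is the internal direct sum of the right ideals ecR and (1−e)dR (that is, ecR + (1−e)dR = R and ecR ∩ (1−e)dR = {0}), and the element w = ec + (1−e)d satisfies RwR = R. -/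
/-- Let `I` be an exchange ideal of a unital ring `R`, `c ∈ I`, `d ∈ R`,
with `cR + dR = R`.  Then there is an idempotent `e` with `e ∈ cR`, `1 - e ∈ dR`,
`ec ∈ cRc`, `(1-e)d ∈ dRd`, `R = ecR ⊕ (1-e)dR` internally, and `w = ec + (1-e)d`
satisfies `RwR = R`. -/
theorem lifting_units_stmt8 {R : Type*} [Ring R] (I : TwoSidedIdeal R)
    (hI : IsExchangeIdeal I)
    (c d : R) (hc : c ∈ I) (hcd : ∃ x y : R, c * x + d * y = 1) :
    ∃ e : R, IsIdempotentElem e ∧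
      (∃ r : R, e = c * r) ∧ (∃ s : R, 1 - e = d * s) ∧
      (∃ r : R, e * c = c * r * c) ∧ (∃ s : R, (1 - e) * d = d * s * d) ∧
      (∀ z : R, ∃ r s : R, z = e * c * r + (1 - e) * d * s) ∧
      (∀ z : R, (∃ r : R, z = e * c * r) → (∃ s : R, z = (1 - e) * d * s) → z = 0) ∧
      (∃ (n : ℕ) (u v : Fin n → R), ∑ i, u i * (e * c + (1 - e) * d) * v i = 1) := by
  obtain ⟨x, y, hxy⟩ := hcd
  obtain ⟨e, -, r, -, s, -, he, her, hes⟩ := hI (c * x) (I.mul_mem_right c x hc)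
  have hca : e = c * (x * r) := by rw [← mul_assoc, ← her]
  have hdb : 1 - e = d * (y * (1 - s)) := by
    rw [← mul_assoc, eq_sub_of_add_eq' hxy, hes]
    noncomm_ring
  generalize x * r = a at hca
  generalize y * (1 - s) = b at hdb
  have hee : e * e = e := he
  have hf : (1 - e) * (1 - e) = 1 - e := he.one_sub
  have hef : e * (1 - e) = 0 := he.mul_one_sub_self
  have hfe : (1 - e) * e = 0 := he.one_sub_mul_self
  have heca : e * c * a = e := by rw [mul_assoc, ← hca, hee]
  have hfdb : (1 - e) * d * b = 1 - e := by rw [mul_assoc, ← hdb, hf]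
  refine ⟨e, he, ⟨a, hca⟩, ⟨b, hdb⟩, ⟨a, by rw [← hca]⟩, ⟨b, by rw [← hdb]⟩, fun z => ?_, ?_, ?_⟩
  · refine ⟨a * z, b * z, ?_⟩
    rw [← mul_assoc, ← mul_assoc, heca, hfdb, ← add_mul, add_sub_cancel, one_mul]
  · rintro z ⟨p, hp⟩ ⟨q, hq⟩
    have hez : e * z = z := by rw [hp, ← mul_assoc, ← mul_assoc, hee]
    rw [← hez, hq, ← mul_assoc, ← mul_assoc, hef, zero_mul, zero_mul]
  · refine ⟨2, ![e, 1 - e], ![a, b], ?_⟩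
    have hew : e * (e * c + (1 - e) * d) = e * c := by
      rw [mul_add, ← mul_assoc, ← mul_assoc, hee, hef, zero_mul, add_zero]
    have hfw : (1 - e) * (e * c + (1 - e) * d) = (1 - e) * d := by
      rw [mul_add, ← mul_assoc, ← mul_assoc, hfe, hf, zero_mul, zero_add]
    simp only [Fin.sum_univ_two, Matrix.cons_val_zero, Matrix.cons_val_one]
    rw [hew, hfw, heca, hfdb, add_sub_cancel]
end

section
/- Let R be a unital ring. Then R, viewed as a right module over itself, has the finite exchange property if and only if for every element a ∈ R there exists an idempotent e ∈ R such that e ∈ aR and 1 − e ∈ (1 − a)R. -/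
universe u

/-- The ring `R`, viewed as a right module over itself (i.e. as an `Rᵐᵒᵖ`-module), has the
*finite exchange property*: for every right `R`-module `A` and all internal direct sum
decompositions `A = M' ⊕ N = A₁ ⊕ … ⊕ A_n` with `M' ≅ R`, there are submodules
`A_i' ⊆ A_i` with `A = M' ⊕ A₁' ⊕ … ⊕ A_n'`. -/
def FiniteExchangeProperty (R : Type u) [Ring R] : Prop :=
  ∀ (A : Type u) [AddCommGroup A] [Module Rᵐᵒᵖ A] (n : ℕ)
    (M' N : Submodule Rᵐᵒᵖ A) (Ai : Fin n → Submodule Rᵐᵒᵖ A),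
    Nonempty (M' ≃ₗ[Rᵐᵒᵖ] R) → IsCompl M' N → DirectSum.IsInternal Ai →
    ∃ Ai' : Fin n → Submodule Rᵐᵒᵖ A, (∀ i, Ai' i ≤ Ai i) ∧
      DirectSum.IsInternal (Fin.cons M' Ai' : Fin (n + 1) → Submodule Rᵐᵒᵖ A)

section DirectSumDecompositions

variable {S : Type*} [Ring S] {A : Type*} [AddCommGroup A] [Module S A]
  {ι : Type*} [Fintype ι] [DecidableEq ι]

theorem DirectSum.isInternal_submodule_iff_forall_sum (B : ι → Submodule S A) :
    DirectSum.IsInternal B ↔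
      (∀ v : ι → A, (∀ i, v i ∈ B i) → ∑ i, v i = 0 → ∀ i, v i = 0) ∧
        ∀ x, ∃ v : ι → A, (∀ i, v i ∈ B i) ∧ ∑ i, v i = x := by
  have hsup (x : A) : x ∈ iSup B ↔ ∃ v : ι → A, (∀ i, v i ∈ B i) ∧ ∑ i, v i = x := by
    have h := Submodule.mem_iSup_finset_iff_exists_sum (s := Finset.univ) B x
    simp only [Finset.mem_univ, iSup_pos] at h
    rw [h]
    exact ⟨fun ⟨μ, hμ⟩ ↦ ⟨fun i ↦ μ i, fun i ↦ (μ i).2, hμ⟩,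
      fun ⟨v, hv, hx⟩ ↦ ⟨fun i ↦ ⟨v i, hv i⟩, hx⟩⟩
  rw [DirectSum.isInternal_submodule_iff_iSupIndep_and_iSup_eq_top,
    iSupIndep_iff_finsetSum_eq_zero_imp_eq_zero, Submodule.eq_top_iff']
  simp only [hsup]
  refine and_congr_left fun _ ↦ ⟨fun h v hv h0 i ↦ h Finset.univ v (fun i _ ↦ hv i) h0 i
    (Finset.mem_univ i), fun h s v hv h0 i hi ↦ ?_⟩
  have := h (fun i ↦ if i ∈ s then v i else 0) (fun i ↦ by
    split_ifs with his
    exacts [hv i his, zero_mem _]) (by simpa using h0) i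
  simpa [hi] using this

theorem DirectSum.IsInternal.exists_projections {B : ι → Submodule S A}
    (h : DirectSum.IsInternal B) :
    ∃ p : ι → A →ₗ[S] A, (∀ i x, p i x ∈ B i) ∧ (∀ x, ∑ i, p i x = x) ∧
      ∀ v : ι → A, (∀ i, v i ∈ B i) → ∀ j, p j (∑ i, v i) = v j := by
  let E := LinearEquiv.ofBijective (DirectSum.coeLinearMap B) h
  have hmem (i : ι) (x : A) : (B i).subtype (E.symm x i) ∈ B i := (E.symm x i).2
  have hsum (x : A) : ∑ i, (B i).subtype (E.symm x i) = x := by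
    conv_rhs => rw [← E.apply_symm_apply x, ← DirectSum.sum_univ_of (E.symm x), map_sum]
    exact Finset.sum_congr rfl fun i _ ↦ (DirectSum.coeLinearMap_of B i _).symm
  refine ⟨fun i ↦ (B i).subtype ∘ₗ DirectSum.component S ι (fun i ↦ B i) i ∘ₗ E.symm.toLinearMap,
    hmem, hsum, fun v hv j ↦ ?_⟩
  refine sub_eq_zero.mp (((DirectSum.isInternal_submodule_iff_forall_sum B).mp h).1
    (fun j ↦ (B j).subtype (E.symm (∑ i, v i) j) - v j)
    (fun i ↦ sub_mem (hmem i _) (hv i)) ?_ j)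
  rw [Finset.sum_sub_distrib, hsum, sub_self]

end DirectSumDecompositions

section Suitable

variable {R : Type*} [Ring R]

/-- The suitability condition is left-right symmetric. -/
theorem exists_idempotent_left_of_right {a : R}
    (h : ∃ e : R, IsIdempotentElem e ∧ (∃ r : R, e = a * r) ∧ (∃ s : R, 1 - e = (1 - a) * s)) :
    ∃ e : R, IsIdempotentElem e ∧ (∃ r : R, e = r * a) ∧ (∃ s : R, 1 - e = s * (1 - a)) := by
  obtain ⟨e, he, ⟨r', hr'⟩, s', hs'⟩ := h
  have he' : e * e = e := he
  obtain ⟨r, hr, hre⟩ : ∃ r, e = a * r ∧ r * e = r :=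
    ⟨r' * e, by rw [← mul_assoc, ← hr', he'], by rw [mul_assoc, he']⟩
  obtain ⟨s, hs, hse⟩ : ∃ s, 1 - e = (1 - a) * s ∧ s * e = 0 :=
    ⟨s' * (1 - e), by rw [← mul_assoc, ← hs', he.one_sub.eq],
      by rw [mul_assoc, sub_mul, one_mul, he', sub_self, mul_zero]⟩
  have hs1 : s = 1 + a * (s - r) := by
    linear_combination (norm := noncomm_ring) -hs - hr
  have hr1 : r = 1 - (1 - a) * (s - r) := by
    linear_combination (norm := noncomm_ring) -hs - hr
  have hsar : s * a * r = 0 := by rw [mul_assoc, ← hr, hse]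
  have hrs : r * (1 - a) * s = 0 := by rw [mul_assoc, ← hs, mul_sub, hre, mul_one, sub_self]
  generalize s - r = t at hs1 hr1
  subst hs1 hr1
  have key : 1 + t * a - (1 - a) * t - t * a * (1 - a) * t = 0 := by
    have h1 : a * (1 + t * a - (1 - a) * t - t * a * (1 - a) * t) = 0 := by
      rw [← hsar]; noncomm_ring
    have h2 : (1 - a) * (1 + t * a - (1 - a) * t - t * a * (1 - a) * t) = 0 := by
      rw [← hrs]; noncomm_ring
    linear_combination (norm := noncomm_ring) h1 + h2
  refine ⟨(1 - t * (1 - a)) * a, ?_, ⟨_, rfl⟩, 1 + t * a, by noncomm_ring⟩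
  have hz : (1 - t * (1 - a)) * a - (1 - t * (1 - a)) * a * ((1 - t * (1 - a)) * a) =
    (1 + t * a - (1 - a) * t - t * a * (1 - a) * t) * (a * (1 - a)) := by noncomm_ring
  rw [key, zero_mul] at hz
  exact (sub_eq_zero.mp hz).symm

/-- If `R` is suitable on the left, then every decomposition of an idempotent `f` as
`∑ i, f * x i * f` can be refined by orthogonal idempotents `r i * x i * f`. -/
theorem exists_orthogonal_refinement
    (hR : ∀ a : R, ∃ e : R, IsIdempotentElem e ∧ (∃ r : R, e = r * a) ∧
      (∃ s : R, 1 - e = s * (1 - a))) (n : ℕ) (f : R) (hf : f * f = f) (x : Fin n → R)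
    (hx : ∑ i, f * x i * f = f) :
    ∃ r : Fin n → R, (∀ i, f * r i = r i) ∧ ∑ i, r i * x i * f = f ∧
      ∀ i j, i ≠ j → r i * x i * r j = 0 := by
  induction n generalizing f with
  | zero => exact ⟨0, fun i ↦ i.elim0, by simpa using hx, fun i ↦ i.elim0⟩
  | succ n ih =>
    obtain ⟨e, he, ⟨u, hu⟩, v, hv⟩ := hR (f * x 0 * f)
    have he' : e * e = e := he
    have hef : e * f = e := by rw [hu]; simp only [mul_assoc, hf]
    obtain ⟨g, hg⟩ : ∃ g, g = f * e := ⟨_, rfl⟩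
    have hfg : f * g = g := by rw [hg, ← mul_assoc, hf]
    have hgf : g * f = g := by rw [hg, mul_assoc, hef]
    have hgg : g * g = g := by
      nth_rw 2 [hg]; rw [← mul_assoc, hgf, hg, mul_assoc, he']
    rw [Fin.sum_univ_succ] at hx
    have hf' : (f - g) * (f - g) = f - g := by
      rw [mul_sub, sub_mul, sub_mul, hf, hgf, hfg, hgg, sub_self, sub_zero]
    have hff' : f * (f - g) = f - g := by rw [mul_sub, hf, hfg]
    have hgf' : g * (f - g) = 0 := by rw [mul_sub, hgf, hgg, sub_self]
    have hcorner : f * v * ∑ i : Fin n, f * x i.succ * f = f - g := by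
      rw [eq_sub_iff_add_eq'.mpr hx]
      calc f * v * (f - f * x 0 * f) = f * (v * (1 - f * x 0 * f)) * f := by
            simp only [mul_sub, sub_mul, mul_one, mul_assoc, hf]
        _ = f - g := by rw [← hv, mul_sub, sub_mul, mul_one, hf, ← hg, hgf]
    obtain ⟨β, hβf, hβsum, hβ⟩ := ih (f - g) hf' (fun i ↦ f * v * f * x i.succ) (by
      calc ∑ i : Fin n, (f - g) * (f * v * f * x i.succ) * (f - g)
          = (f - g) * (f * v * ∑ i : Fin n, f * x i.succ * f) * (f - g) := by
            simp only [Finset.mul_sum, Finset.sum_mul]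
            refine Finset.sum_congr rfl fun i _ ↦ ?_
            simp only [mul_assoc, hff']
        _ = f - g := by rw [hcorner, hf', hf'])
    obtain ⟨γ, hγ⟩ : ∃ γ : Fin n → R, ∀ i, γ i = β i * (f * v * f) :=
      ⟨_, fun _ ↦ rfl⟩
    have hγf' (i) : (f - g) * γ i = γ i := by rw [hγ, ← mul_assoc, hβf]
    have hγf (i) : f * γ i = γ i := by rw [← hγf' i, ← mul_assoc, hff']
    have hgγ (i) : g * γ i = 0 := by rw [← hγf' i, ← mul_assoc, hgf', zero_mul]
    have hγsum : ∑ i, γ i * x i.succ * (f - g) = f - g := by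
      refine (Finset.sum_congr rfl fun i _ ↦ ?_).trans hβsum
      simp only [hγ, mul_assoc]
    have hγγ (i j) (hij : i ≠ j) : γ i * x i.succ * γ j = 0 := by
      rw [hγ j, ← mul_assoc, hγ i]
      have := hβ i j hij
      simp only [mul_assoc] at this ⊢
      simp only [← mul_assoc] at this ⊢
      rw [this]; simp
    have hγself (i) : γ i * x i.succ * γ i = γ i := by
      conv_rhs => rw [← hγf' i, ← hγsum, Finset.sum_mul]
      rw [Finset.sum_eq_single i]
      · rw [mul_assoc _ (f - g), hγf']
      · intro j _ hj
        rw [mul_assoc _ (f - g), hγf', hγγ j i hj]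
      · simp
    obtain ⟨α, hα, hgα⟩ : ∃ α, α * x 0 * f = g ∧ g * α = α := by
      refine ⟨g * f * u * f, ?_, by simp only [← mul_assoc, hgg]⟩
      calc g * f * u * f * x 0 * f = g * (f * (u * (f * x 0 * f))) := by simp only [mul_assoc]
        _ = g := by rw [← hu, ← hg, hgg]
    obtain ⟨y, hy⟩ : ∃ y, y = ∑ i, γ i * x i.succ * g := ⟨_, rfl⟩
    have hyg : y * g = y := by
      simp only [hy, Finset.sum_mul, mul_assoc, hgg]
    have hfy : f * y = y := by
      simp only [hy, Finset.mul_sum, ← mul_assoc, hγf]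
    have hγy (i) : γ i * x i.succ * y = γ i * x i.succ * g := by
      rw [hy, Finset.mul_sum, Finset.sum_eq_single i]
      · simp only [← mul_assoc, hγself]
      · intro j _ hj
        simp only [← mul_assoc, hγγ i j hj.symm, zero_mul]
      · simp
    refine ⟨Fin.cons ((1 - y) * α) γ, fun i ↦ ?_, ?_, fun i j ↦ ?_⟩
    · cases i using Fin.cases with
      | zero =>
        rw [Fin.cons_zero, ← hgα]
        simp only [← mul_assoc, mul_sub, sub_mul, one_mul, hfg, hfy]
      | succ i => rw [Fin.cons_succ, hγf]
    · rw [Fin.sum_univ_succ]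
      simp only [Fin.cons_zero, Fin.cons_succ]
      have h1 : (1 - y) * α * x 0 * f = g - y := by
        rw [mul_assoc, mul_assoc, ← mul_assoc α, hα, sub_mul, one_mul, hyg]
      have h2 : ∑ i : Fin n, γ i * x i.succ * f = f - g + y := by
        rw [hy, ← hγsum, ← Finset.sum_add_distrib]
        exact Finset.sum_congr rfl fun i _ ↦ by
          rw [← mul_add, sub_add_cancel]
      rw [h1, h2]; abel
    · cases i using Fin.cases with
      | zero =>
        cases j using Fin.cases with
        | zero => exact fun h ↦ (h rfl).elim
        | succ j =>
          intro _
          simp only [Fin.cons_zero, Fin.cons_succ]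
          rw [← hγf j, ← mul_assoc, mul_assoc (1 - y), mul_assoc (1 - y), hα, mul_assoc, hgγ,
            mul_zero]
      | succ i =>
        cases j using Fin.cases with
        | zero =>
          intro _
          simp only [Fin.cons_zero, Fin.cons_succ]
          rw [← hgα, ← mul_assoc, ← mul_assoc, mul_sub, mul_one, hγy, sub_mul, mul_assoc _ g g,
            hgg, sub_self, zero_mul]
        | succ j =>
          intro hij
          simp only [Fin.cons_succ]
          exact hγγ i j fun h ↦ hij (congrArg _ h)

end Suitable

theorem FiniteExchangeProperty.exists_idempotent {R : Type u} [Ring R]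
    (hR : FiniteExchangeProperty R) (a : R) :
    ∃ e : R, IsIdempotentElem e ∧ (∃ r : R, e = a * r) ∧ (∃ s : R, 1 - e = (1 - a) * s) := by
  let K : Submodule Rᵐᵒᵖ (R × R) :=
    { carrier := {p | a * p.1 + (1 - a) * p.2 = 0}
      add_mem' := fun {p q} hp hq ↦ by
        simp only [Set.mem_ofPred_eq, Prod.fst_add, Prod.snd_add, mul_add] at hp hq ⊢
        rw [add_add_add_comm, hp, hq, add_zero]
      zero_mem' := by simp
      smul_mem' := fun c p hp ↦ by
        simp only [Set.mem_ofPred_eq, Prod.smul_fst, Prod.smul_snd, MulOpposite.smul_eq_mul_unop,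
          ← mul_assoc] at hp ⊢
        rw [← add_mul, hp, zero_mul] }
  have hK (p : R × R) : p ∈ K ↔ a * p.1 + (1 - a) * p.2 = 0 := Iff.rfl
  let D : Submodule Rᵐᵒᵖ (R × R) := LinearMap.ker (LinearMap.fst Rᵐᵒᵖ R R - LinearMap.snd Rᵐᵒᵖ R R)
  have hD (p : R × R) : p ∈ D ↔ p.1 = p.2 := by simp [D, sub_eq_zero]
  let B : Fin 2 → Submodule Rᵐᵒᵖ (R × R) :=
    ![LinearMap.ker (LinearMap.snd Rᵐᵒᵖ R R), LinearMap.ker (LinearMap.fst Rᵐᵒᵖ R R)]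
  have hB : DirectSum.IsInternal B := by
    rw [DirectSum.isInternal_submodule_iff_forall_sum]
    refine ⟨fun v hv h0 ↦ ?_, fun x ↦ ⟨![(x.1, 0), (0, x.2)], ?_, by simp⟩⟩
    · have h1 : (v 0).2 = 0 := hv 0
      have h2 : (v 1).1 = 0 := hv 1
      rw [Fin.sum_univ_two] at h0
      have h3 := congrArg Prod.fst h0
      have h4 := congrArg Prod.snd h0
      simp [h1, h2] at h3 h4
      intro i
      fin_cases i
      · exact Prod.ext h3 h1
      · exact Prod.ext h2 h4
    · intro i
      fin_cases i <;> simp [B]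
  have hKD : IsCompl K D := by
    rw [isCompl_iff, Submodule.disjoint_def, codisjoint_iff, Submodule.eq_top_iff']
    refine ⟨fun p hp hp' ↦ ?_, fun p ↦ ?_⟩
    · rw [hK] at hp
      rw [hD] at hp'
      rw [← hp', ← add_mul, add_sub_cancel, one_mul] at hp
      exact Prod.ext hp (hp' ▸ hp)
    · rw [Submodule.mem_sup]
      let c := a * p.1 + (1 - a) * p.2
      refine ⟨p - (c, c), ?_, (c, c), (hD _).mpr rfl, sub_add_cancel _ _⟩
      rw [hK]
      simp only [Prod.fst_sub, Prod.snd_sub, c]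
      noncomm_ring
  let φ : K ≃ₗ[Rᵐᵒᵖ] R :=
    { toFun := fun p ↦ p.1.1 - p.1.2
      map_add' := fun p q ↦ by simp only [Submodule.coe_add, Prod.fst_add, Prod.snd_add]; abel
      map_smul' := fun c p ↦ by simp [smul_sub]
      invFun := fun z ↦ ⟨((1 - a) * z, -(a * z)), by rw [hK]; noncomm_ring⟩
      left_inv := fun ⟨p, hp⟩ ↦ by
        rw [hK] at hp
        refine Subtype.ext (Prod.ext ?_ ?_)
        · linear_combination (norm := noncomm_ring) -hp
        · linear_combination (norm := noncomm_ring) -hp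
      right_inv := fun z ↦ by
        dsimp only
        noncomm_ring }
  obtain ⟨B', hB'B, hB'⟩ := hR (R × R) 2 K D B ⟨φ⟩ hKD hB
  rw [DirectSum.isInternal_submodule_iff_forall_sum] at hB'
  obtain ⟨hindep, hspan⟩ := hB'
  obtain ⟨v, hv, hsum⟩ := hspan (1, 1)
  have hv0 : a * (v 0).1 + (1 - a) * (v 0).2 = 0 := hv 0
  have hv1 : v 1 ∈ B' 0 := hv 1
  have hv2 : v 2 ∈ B' 1 := hv 2
  have hb : (v 1).2 = 0 := hB'B 0 hv1
  have hc : (v 2).1 = 0 := hB'B 1 hv2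
  rw [Fin.sum_univ_three] at hsum
  have hs1 : (v 0).1 + (v 1).1 = 1 := by simpa [hc] using congrArg Prod.fst hsum
  have hs2 : (v 0).2 + (v 2).2 = 1 := by simpa [hb] using congrArg Prod.snd hsum
  have hone : a * (v 1).1 + (1 - a) * (v 2).2 = 1 := by
    rw [← eq_sub_iff_add_eq'] at hs1 hs2
    rw [hs1, hs2, mul_sub, mul_sub]
    linear_combination (norm := noncomm_ring) -hv0
  refine ⟨a * (v 1).1, ?_, ⟨_, rfl⟩, (v 2).2, sub_eq_iff_eq_add'.mpr hone.symm⟩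
  generalize he : a * (v 1).1 = e at hone
  have he' : (1 - a) * (v 2).2 = 1 - e := eq_sub_of_add_eq' hone
  have key := hindep ![-(MulOpposite.op (1 - e) • v 1 - MulOpposite.op e • v 2),
    MulOpposite.op (1 - e) • v 1, -(MulOpposite.op e • v 2)] (by
      intro i
      fin_cases i
      · refine neg_mem ((hK _).mpr ?_)
        simp only [Prod.fst_sub, Prod.snd_sub, Prod.smul_fst, Prod.smul_snd,
          MulOpposite.smul_eq_mul_unop, MulOpposite.unop_op, hb, hc, zero_mul, sub_zero, zero_sub,
          mul_neg, ← mul_assoc, he, he']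
        noncomm_ring
      · exact Submodule.smul_mem _ _ hv1
      · exact neg_mem (Submodule.smul_mem _ _ hv2)) (by
      rw [Fin.sum_univ_three]
      simp only [Matrix.cons_val]
      abel) 1
  have h0 : (v 1).1 * (1 - e) = 0 := congrArg Prod.fst key
  have h1 : e * (1 - e) = 0 := by
    rw [← he, mul_assoc, he, h0, mul_zero]
  rw [mul_sub, mul_one, sub_eq_zero] at h1
  exact h1.symm

theorem finiteExchangeProperty_of_exists_idempotent {R : Type u} [Ring R]
    (hR : ∀ a : R, ∃ e : R, IsIdempotentElem e ∧
      (∃ r : R, e = a * r) ∧ (∃ s : R, 1 - e = (1 - a) * s)) :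
    FiniteExchangeProperty R := by
  intro A _ _ n M' N B ⟨φ⟩ hMN hB
  obtain ⟨p, hpmem, hpsum, hpval⟩ := hB.exists_projections
  let g : A →ₗ[Rᵐᵒᵖ] R := φ.toLinearMap ∘ₗ M'.projectionOnto N hMN
  let f : R →ₗ[Rᵐᵒᵖ] A := M'.subtype ∘ₗ φ.symm.toLinearMap
  have hfM (t : R) : f t ∈ M' := (φ.symm t).2
  have hMf (m : A) (hm : m ∈ M') : ∃ t, f t = m := ⟨φ ⟨m, hm⟩, by simp [f]⟩
  have hgf (t : R) : g (f t) = t := by simp [g, f]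
  let a : Fin n → R := fun i ↦ g (p i (f 1))
  have hgpf (i : Fin n) (t : R) : g (p i (f t)) = a i * t := by
    conv_lhs => rw [← one_mul t, ← op_smul_eq_mul, map_smul, map_smul, map_smul]
    exact op_smul_eq_mul t (a i)
  obtain ⟨r, -, hrsum, hr⟩ := exists_orthogonal_refinement
    (fun a ↦ exists_idempotent_left_of_right (hR a)) n 1 (one_mul 1) a (by
      simp only [one_mul, mul_one, a]
      rw [← map_sum, hpsum, hgf])
  simp only [mul_one] at hrsum
  have hrself (i : Fin n) : r i * a i * r i = r i := by
    conv_rhs => rw [← one_mul (r i), ← hrsum, Finset.sum_mul]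
    rw [Finset.sum_eq_single i (fun j _ hj ↦ hr j i hj) (by simp)]
  let C : Fin n → Submodule Rᵐᵒᵖ A := fun i ↦
    { carrier := {x | x ∈ B i ∧ r i * g x = 0}
      add_mem' := fun {x y} hx hy ↦ ⟨add_mem hx.1 hy.1, by
        rw [map_add, mul_add, hx.2, hy.2, add_zero]⟩
      zero_mem' := ⟨zero_mem _, by simp⟩
      smul_mem' := fun c x hx ↦ ⟨Submodule.smul_mem _ _ hx.1, by
        rw [map_smul, MulOpposite.smul_eq_mul_unop, ← mul_assoc, hx.2, zero_mul]⟩ }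
  refine ⟨C, fun i x hx ↦ hx.1, ?_⟩
  rw [DirectSum.isInternal_submodule_iff_forall_sum]
  refine ⟨fun v hv h0 ↦ ?_, fun x ↦ ?_⟩
  · obtain ⟨t, ht⟩ := hMf (v 0) (hv 0)
    have hvC (i : Fin n) : v i.succ ∈ B i ∧ r i * g (v i.succ) = 0 := hv i.succ
    rw [Fin.sum_univ_succ, ← ht] at h0
    have hp (j : Fin n) : p j (f t) + v j.succ = 0 := by
      rw [← hpval (fun i ↦ v i.succ) (fun i ↦ (hvC i).1) j, ← map_add, h0, map_zero]
    have hrat (j : Fin n) : r j * a j * t = 0 := by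
      rw [mul_assoc, ← hgpf, eq_neg_of_add_eq_zero_left (hp j), map_neg, mul_neg, (hvC j).2,
        neg_zero]
    have ht0 : t = 0 := by
      rw [← one_mul t, ← hrsum, Finset.sum_mul]
      exact Finset.sum_eq_zero fun j _ ↦ hrat j
    intro i
    cases i using Fin.cases with
    | zero => rw [← ht, ht0, map_zero]
    | succ i => simpa [ht0] using hp i
  · let t := ∑ j, r j * g (p j x)
    refine ⟨Fin.cons (f t) fun i ↦ p i (x - f t), fun i ↦ ?_, ?_⟩
    · cases i using Fin.cases with
      | zero => exact hfM t
      | succ i =>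
        refine ⟨hpmem _ _, ?_⟩
        rw [Fin.cons_succ, map_sub, map_sub, hgpf, mul_sub, ← mul_assoc, Finset.mul_sum,
          Finset.sum_eq_single i, ← mul_assoc, hrself, sub_self]
        · intro j _ hj
          rw [← mul_assoc, hr i j hj.symm, zero_mul]
        · simp
    · rw [Fin.sum_univ_succ]
      simp only [Fin.cons_zero, Fin.cons_succ, hpsum, add_sub_cancel]

/-- A unital ring `R`, as a right module over itself, has the finite
exchange property if and only if for every `a ∈ R` there is an idempotent `e ∈ aR` with
`1 - e ∈ (1 - a)R`. -/
theorem lifting_units_stmt9 (R : Type u) [Ring R] :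
    FiniteExchangeProperty R ↔
      ∀ a : R, ∃ e : R, IsIdempotentElem e ∧
        (∃ r : R, e = a * r) ∧ (∃ s : R, 1 - e = (1 - a) * s) :=
  ⟨FiniteExchangeProperty.exists_idempotent, finiteExchangeProperty_of_exists_idempotent⟩
end
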